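/- arXiv:1305.6212 — 3 statements merged into one kernel-verified Lean document; each statement's English description precedes it below -/
import Mathlib

section
/- For any two quadruples of generators Q and Q' of A, there exists a chain Q = Q₀, Q₁, ..., Qₙ = Q' of quadruples of generators with n ≤ 45 such that each consecutive pair Qᵢ, Qᵢ₊₁ is related by a step of type Λ₁, Ω_i, Ω_s, or Ω_c, and at most 6 of the steps are of type Ω_i, Ω_s, or Ω_c (all the remaining steps being of type Λ₁). -/
/-- `x` is an Artin–Schreier element: `x² + x ∈ F·1`. -/
def IsArtinSchreier (F : Type*) {A : Type*} [Field F] [Ring A] [Algebra F A] (x : A) : Prop :=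
  x ^ 2 + x ∈ Set.range (algebraMap F A)

/-- `y` is a square-central element: `y² ∈ F·1`. -/
def IsSquareCentral (F : Type*) {A : Type*} [Field F] [Ring A] [Algebra F A] (y : A) : Prop :=
  y ^ 2 ∈ Set.range (algebraMap F A)

/-- `(x, y, z, u)` is a quadruple of generators of the biquaternion algebra `A`. -/
def IsQuadruple (F : Type*) {A : Type*} [Field F] [Ring A] [Algebra F A]
    (q : A × A × A × A) : Prop :=
  match q with
  | (x, y, z, u) =>
    y ≠ 0 ∧ u ≠ 0 ∧
    IsArtinSchreier F x ∧ IsSquareCentral F y ∧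
    IsArtinSchreier F z ∧ IsSquareCentral F u ∧
    x * y + y * x = y ∧ x * z = z * x ∧ x * u = u * x ∧
    y * z = z * y ∧ y * u = u * y ∧ z * u + u * z = u

/-- Swapping the two pairs of a quadruple: `(x, y, z, u) ↦ (z, u, x, y)`. -/
def quadSwap {A : Type*} (q : A × A × A × A) : A × A × A × A :=
  (q.2.2.1, q.2.2.2, q.1, q.2.1)

/-- At least three of the four entries agree. -/
def AgreeThree {A : Type*} (q r : A × A × A × A) : Prop :=
  (q.1 = r.1 ∧ q.2.1 = r.2.1 ∧ q.2.2.1 = r.2.2.1) ∨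
  (q.1 = r.1 ∧ q.2.1 = r.2.1 ∧ q.2.2.2 = r.2.2.2) ∨
  (q.1 = r.1 ∧ q.2.2.1 = r.2.2.1 ∧ q.2.2.2 = r.2.2.2) ∨
  (q.2.1 = r.2.1 ∧ q.2.2.1 = r.2.2.1 ∧ q.2.2.2 = r.2.2.2)

/-- A step of type `Λ₁`: after possibly pair-swapping the target quadruple, at most one
generator is changed. -/
def Lambda1Step {A : Type*} (q q' : A × A × A × A) : Prop :=
  AgreeThree q q' ∨ AgreeThree q (quadSwap q')

/-- The relation underlying the `Ω_s` step: `x` and `z` are preserved and `y` and `u` are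
multiplied by `a + b (x + z)` for some `a, b ∈ F`. -/
def OmegaSRel (F : Type*) {A : Type*} [Field F] [Ring A] [Algebra F A]
    (q r : A × A × A × A) : Prop :=
  match q, r with
  | (x, y, z, u), (x', y', z', u') =>
    x' = x ∧ z' = z ∧ ∃ a b : F,
      y' = (a • (1 : A) + b • (x + z)) * y ∧ u' = (a • (1 : A) + b • (x + z)) * u

/-- A step of type `Ω_s`, up to pair-swapping the target quadruple. -/
def OmegaSStep (F : Type*) {A : Type*} [Field F] [Ring A] [Algebra F A]
    (q q' : A × A × A × A) : Prop :=
  OmegaSRel F q q' ∨ OmegaSRel F q (quadSwap q')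

/-- The relation underlying the `Ω_i` step: `y` and `u` are preserved and an element of the
form `a·y·u` is added to `x` and `z` for some `a ∈ F`. -/
def OmegaIRel (F : Type*) {A : Type*} [Field F] [Ring A] [Algebra F A]
    (q r : A × A × A × A) : Prop :=
  match q, r with
  | (x, y, z, u), (x', y', z', u') =>
    y' = y ∧ u' = u ∧ ∃ a : F, x' = x + a • (y * u) ∧ z' = z + a • (y * u)

/-- A step of type `Ω_i`, up to pair-swapping the target quadruple. -/
def OmegaIStep (F : Type*) {A : Type*} [Field F] [Ring A] [Algebra F A]
    (q q' : A × A × A × A) : Prop :=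
  OmegaIRel F q q' ∨ OmegaIRel F q (quadSwap q')

/-- The relation underlying the `Ω_c` step: `y` and `z` are preserved, `x` changes to
`x + b y (1 + b y)⁻¹ z` and `u` changes to `(1 + b y) u` for some `b ∈ F` with `1 + b y`
invertible. -/
def OmegaCRel (F : Type*) {A : Type*} [Field F] [DivisionRing A] [Algebra F A]
    (q r : A × A × A × A) : Prop :=
  match q, r with
  | (x, y, z, u), (x', y', z', u') =>
    y' = y ∧ z' = z ∧ ∃ b : F, IsUnit (1 + b • y) ∧
      x' = x + (b • y) * (1 + b • y)⁻¹ * z ∧ u' = (1 + b • y) * u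

/-- A step of type `Ω_c`, up to pair-swapping the target quadruple. -/
def OmegaCStep (F : Type*) {A : Type*} [Field F] [DivisionRing A] [Algebra F A]
    (q q' : A × A × A × A) : Prop :=
  OmegaCRel F q q' ∨ OmegaCRel F q (quadSwap q')

section Pairs

variable {F A : Type*} [Field F] [DivisionRing A] [Algebra F A]

/-- `x` and `y` generate a quaternion algebra, `x` being Artin–Schreier and `y` square-central. -/
structure QPair (F : Type*) {A : Type*} [Field F] [DivisionRing A] [Algebra F A] (x y : A) :
    Prop where
  ne : y ≠ 0
  artinSchreier : ∃ α : F, x * x = x + α • (1 : A)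
  squareCentral : ∃ β : F, y * y = β • (1 : A)
  rel : y * x = x * y + y

variable (F) in
theorem charP_two_of_algebra [CharP F 2] : CharP A 2 :=
  charP_of_injective_algebraMap (algebraMap F A).injective 2

theorem isQuadruple_iff [CharP F 2] {x y z u : A} :
    IsQuadruple F (x, y, z, u) ↔ QPair F x y ∧ QPair F z u ∧
      x * z = z * x ∧ x * u = u * x ∧ y * z = z * y ∧ y * u = u * y := by
  have := charP_two_of_algebra F (A := A)
  have has : ∀ x : A, IsArtinSchreier F x ↔ ∃ α : F, x * x = x + α • (1 : A) := by
    intro x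
    refine exists_congr fun α => ?_
    rw [Algebra.algebraMap_eq_smul_one]
    constructor <;> intro h
    · rw [h]; grind
    · rw [pow_two, h]; grind
  have hsc : ∀ x : A, IsSquareCentral F x ↔ ∃ α : F, x * x = α • (1 : A) := by
    intro x
    refine exists_congr fun α => ?_
    rw [Algebra.algebraMap_eq_smul_one, pow_two, eq_comm]
  have hrel : ∀ x y : A, x * y + y * x = y ↔ y * x = x * y + y := by
    intro x y
    constructor <;> intro h
    · linear_combination (norm := skip) h
      grind
    · linear_combination (norm := skip) h
      grind
  simp only [IsQuadruple, has, hsc, hrel]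
  constructor
  · rintro ⟨h1, h2, h3, h4, h5, h6, h7, h8, h9, h10, h11, h12⟩
    exact ⟨⟨h1, h3, h4, h7⟩, ⟨h2, h5, h6, h12⟩, h8, h9, h10, h11⟩
  · rintro ⟨⟨h1, h3, h4, h7⟩, ⟨h2, h5, h6, h12⟩, h8, h9, h10, h11⟩
    exact ⟨h1, h2, h3, h4, h5, h6, h7, h8, h9, h10, h11, h12⟩

theorem ne_zero_of_mul_self_eq_smul {y : A} {β : F} (hy : y ≠ 0) (h : y * y = β • (1 : A)) :
    β ≠ 0 := by
  rintro rfl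
  rw [zero_smul] at h
  exact hy (mul_self_eq_zero.mp h)

namespace QPair

theorem of_plane [CharP F 2] {x y : A} (h : QPair F x y) (c d : F)
    (hne : c • y + d • (x * y) ≠ 0) : QPair F x (c • y + d • (x * y)) := by
  obtain ⟨-, ⟨α, hα⟩, ⟨β, hβ⟩, hr⟩ := h
  have hα' : ∀ w, x * (x * w) = x * w + α • w := fun w => by
    rw [← mul_assoc, hα, add_mul, smul_mul_assoc, one_mul]
  have hβ' : ∀ w, y * (y * w) = β • w := fun w => by
    rw [← mul_assoc, hβ, smul_mul_assoc, one_mul]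
  have hr' : ∀ w, y * (x * w) = x * (y * w) + y * w := fun w => by
    rw [← mul_assoc, hr, add_mul, mul_assoc]
  refine ⟨hne, ⟨α, hα⟩, ⟨β * (c ^ 2 + c * d + d ^ 2 * α), ?_⟩, ?_⟩
  · simp only [mul_add, add_mul, mul_assoc, smul_mul_assoc, mul_smul_comm, smul_add, smul_smul,
      hα, hβ, hr, hα', hβ', hr', mul_one, one_mul]
    match_scalars <;> grind
  · simp only [mul_add, add_mul, mul_assoc, smul_mul_assoc, mul_smul_comm, smul_add, smul_smul,
      hα, hβ, hr, hα', hβ', hr', mul_one, one_mul]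
    match_scalars <;> grind

theorem add_left [CharP F 2] {x y : A} (h : QPair F x y) (c d : F) :
    QPair F (x + c • (1 : A) + d • y) y := by
  obtain ⟨hne, ⟨α, hα⟩, ⟨β, hβ⟩, hr⟩ := h
  refine ⟨hne, ⟨α + c ^ 2 + c + d ^ 2 * β, ?_⟩, ⟨β, hβ⟩, ?_⟩
  · simp only [mul_add, add_mul, mul_assoc, smul_mul_assoc, mul_smul_comm, smul_add, smul_smul,
      hα, hβ, hr, mul_one, one_mul]
    match_scalars <;> grind
  · simp only [mul_add, add_mul, mul_assoc, smul_mul_assoc, mul_smul_comm, smul_add, smul_smul,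
      hα, hβ, hr, mul_one, one_mul]
    match_scalars <;> grind

theorem of_anticomm [CharP F 2] {u v : A} {c : F} (hu : ∃ β : F, u * u = β • (1 : A))
    (hv : ∃ β : F, v * v = β • (1 : A)) (hc : c ≠ 0) (h : u * v + v * u = c • (1 : A)) :
    QPair F (c⁻¹ • (u * v)) u ∧ QPair F (c⁻¹ • (u * v)) v := by
  have := charP_two_of_algebra F (A := A)
  obtain ⟨β, hβ⟩ := hu
  obtain ⟨γ, hγ⟩ := hv
  have hr : v * u = u * v + c • (1 : A) := by rw [← h]; grind
  have hr' : ∀ w, v * (u * w) = u * (v * w) + c • w := fun w => by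
    rw [← mul_assoc, hr, add_mul, mul_assoc, smul_mul_assoc, one_mul]
  have hβ' : ∀ w, u * (u * w) = β • w := fun w => by
    rw [← mul_assoc, hβ, smul_mul_assoc, one_mul]
  have hone : (c • (1 : A)) ≠ 0 := smul_ne_zero hc one_ne_zero
  have has : ∃ α : F, c⁻¹ • (u * v) * c⁻¹ • (u * v) = c⁻¹ • (u * v) + α • (1 : A) := by
    refine ⟨c⁻¹ ^ 2 * β * γ, ?_⟩
    simp only [mul_add, mul_assoc, smul_mul_assoc, mul_smul_comm, smul_add, smul_smul,
      hβ, hβ', hγ, hr', mul_one]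
    match_scalars <;> field_simp
  refine ⟨⟨?_, has, ⟨β, hβ⟩, ?_⟩, ⟨?_, has, ⟨γ, hγ⟩, ?_⟩⟩
  · rintro rfl
    exact hone (by simpa using h.symm)
  · simp only [mul_add, mul_assoc, smul_mul_assoc, mul_smul_comm, smul_add, smul_smul,
      hβ', hβ, hr, mul_one]
    match_scalars <;> field_simp <;> grind
  · rintro rfl
    exact hone (by simpa using h.symm)
  · simp only [mul_assoc, smul_mul_assoc, mul_smul_comm, smul_add, smul_smul,
      hγ, hr', mul_one]
    match_scalars <;> field_simp

/-- A pair is free over its centralizer. -/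
theorem coeff_eq_zero [CharP F 2] {x y p q r t : A} (h : QPair F x y)
    (hpx : p * x = x * p) (hpy : p * y = y * p) (hqx : q * x = x * q) (hqy : q * y = y * q)
    (hrx : r * x = x * r) (hry : r * y = y * r) (htx : t * x = x * t) (hty : t * y = y * t)
    (hz : p + x * q + y * r + x * y * t = 0) : p = 0 ∧ q = 0 ∧ r = 0 ∧ t = 0 := by
  have := charP_two_of_algebra F (A := A)
  obtain ⟨hne, ⟨α, hα⟩, ⟨β, hβ⟩, hr⟩ := h
  have key : ∀ p q : A, p * y = y * p → q * y = y * q → p + x * q = 0 → p = 0 ∧ q = 0 := by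
    intro p q hp hq h0
    have h1 : y * q = 0 := by
      linear_combination (norm := skip) y * h0 + h0 * y - hp - hr * q - x * hq
      grind
    have hq0 := (mul_eq_zero.mp h1).resolve_left hne
    subst hq0
    simpa using h0
  have h1 : y * (r + x * t) + y * t = 0 := by
    linear_combination (norm := skip) x * hz + hz * x - hpx - x * hqx - y * hrx - x * y * htx
      - hr * r - x * hr * t - hr * t
    grind
  have h2 : (r + t) + x * t = 0 := by
    have : y * ((r + t) + x * t) = 0 := by rw [← h1]; simp only [mul_add]; abel
    exact (mul_eq_zero.mp this).resolve_left hne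
  obtain ⟨h3, rfl⟩ := key (r + t) t (by rw [add_mul, mul_add, hry, hty]) hty h2
  rw [add_zero] at h3
  subst h3
  obtain ⟨rfl, rfl⟩ := key p q hpy hqy (by simpa using hz)
  simp

end QPair

end Pairs

section Chains

variable {F A : Type*} [Field F] [DivisionRing A] [Algebra F A]

/-- One of the three non-elementary steps. -/
def OmegaStep (F : Type*) {A : Type*} [Field F] [DivisionRing A] [Algebra F A]
    (q r : A × A × A × A) : Prop :=
  OmegaIStep F q r ∨ OmegaSStep F q r ∨ OmegaCStep F q r

/-- `Reach F k m q r`: a chain of quadruples leads from `q` to `r` with exactly `k` steps of type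
`Λ₁` and `m` steps of type `Ω`. -/
inductive Reach (F : Type*) {A : Type*} [Field F] [DivisionRing A] [Algebra F A] :
    ℕ → ℕ → A × A × A × A → A × A × A × A → Prop
  | refl {q : A × A × A × A} : IsQuadruple F q → Reach F 0 0 q q
  | lambda {k m : ℕ} {q r s : A × A × A × A} :
      Reach F k m q r → Lambda1Step r s → IsQuadruple F s → Reach F (k + 1) m q s
  | omega {k m : ℕ} {q r s : A × A × A × A} :
      Reach F k m q r → OmegaStep F r s → IsQuadruple F s → Reach F k (m + 1) q s

namespace Reach

theorem right_isQuadruple {k m : ℕ} {q r : A × A × A × A} (h : Reach F k m q r) :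
    IsQuadruple F r := by
  cases h <;> assumption

theorem trans {k m k' m' : ℕ} {q r s : A × A × A × A} (h : Reach F k m q r)
    (h' : Reach F k' m' r s) : Reach F (k + k') (m + m') q s := by
  induction h' with
  | refl _ => exact h
  | lambda _ h2 h3 ih => exact (ih h).lambda h2 h3
  | omega _ h2 h3 ih => exact (ih h).omega h2 h3

theorem single_lambda {q r : A × A × A × A} (hq : IsQuadruple F q) (h : Lambda1Step q r)
    (hr : IsQuadruple F r) : Reach F 1 0 q r :=
  (Reach.refl hq).lambda h hr

theorem pad_lambda {m k k' : ℕ} {q r : A × A × A × A} (h : Reach F k m q r) (hk : k ≤ k') :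
    Reach F k' m q r := by
  induction hk with
  | refl => exact h
  | step _ ih => exact ih.lambda (Or.inl (Or.inl ⟨rfl, rfl, rfl⟩)) h.right_isQuadruple

theorem pad_omega {m m' k : ℕ} {q r : A × A × A × A} (h : Reach F k m q r) (hm : m ≤ m') :
    Reach F k m' q r := by
  induction hm with
  | refl => exact h
  | step _ ih =>
    refine ih.omega (Or.inl (Or.inl ?_)) h.right_isQuadruple
    obtain ⟨x, y, z, u⟩ := r
    exact ⟨rfl, rfl, 0, by simp, by simp⟩

theorem exists_chain {k m : ℕ} {q r : A × A × A × A} (h : Reach F k m q r) :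
    ∃ c : ℕ → A × A × A × A, ∃ t : ℕ → Bool,
      c 0 = q ∧ c (k + m) = r ∧ (∀ i ≤ k + m, IsQuadruple F (c i)) ∧
      (∀ i < k + m, if t i then Lambda1Step (c i) (c (i + 1)) else OmegaStep F (c i) (c (i + 1))) ∧
      ((Finset.range (k + m)).filter fun i => t i = false).card = m := by
  have extend : ∀ (n : ℕ) (c : ℕ → A × A × A × A) (t : ℕ → Bool) (b : Bool)
      (s : A × A × A × A) (j : ℕ), (∀ i ≤ n, IsQuadruple F (c i)) →
      (∀ i < n, if t i then Lambda1Step (c i) (c (i + 1)) else OmegaStep F (c i) (c (i + 1))) →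
      ((Finset.range n).filter fun i => t i = false).card = j → IsQuadruple F s →
      (if b then Lambda1Step (c n) s else OmegaStep F (c n) s) →
      ∃ c' : ℕ → A × A × A × A, ∃ t' : ℕ → Bool, c' 0 = c 0 ∧ c' (n + 1) = s ∧
        (∀ i ≤ n + 1, IsQuadruple F (c' i)) ∧
        (∀ i < n + 1,
          if t' i then Lambda1Step (c' i) (c' (i + 1)) else OmegaStep F (c' i) (c' (i + 1))) ∧
        ((Finset.range (n + 1)).filter fun i => t' i = false).card =
          j + if b then 0 else 1 := by
    intro n c t b s j hc ht hj hs hb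
    refine ⟨fun i => if i ≤ n then c i else s, fun i => if i < n then t i else b,
      by simp, by simp, ?_, ?_, ?_⟩
    · intro i _
      by_cases hi : i ≤ n <;> simp [hi, hs, hc]
    · intro i hi
      rcases Nat.lt_succ_iff_lt_or_eq.mp hi with h1 | rfl
      · simpa [h1, h1.le, Nat.succ_le_of_lt h1] using ht i h1
      · simpa using hb
    · rw [Finset.range_add_one, Finset.filter_insert]
      have : (Finset.range n).filter (fun i => (if i < n then t i else b) = false) =
          (Finset.range n).filter fun i => t i = false :=
        Finset.filter_congr fun i hi => by simp [Finset.mem_range.mp hi]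
      rw [this]
      cases b <;> simp [hj]
  induction h with
  | refl h => exact ⟨fun _ => _, fun _ => true, rfl, rfl, by simpa using h, by simp, by simp⟩
  | @lambda k m q r s _ h2 h3 ih =>
    obtain ⟨c, t, h0, hn, hc, ht, hj⟩ := ih
    obtain ⟨c', t', h0', hn', hc', ht', hj'⟩ :=
      extend _ c t true s _ hc ht hj h3 (by simpa [hn] using h2)
    rw [Nat.add_right_comm]
    exact ⟨c', t', h0'.trans h0, hn', hc', ht', by simpa using hj'⟩
  | @omega k m q r s _ h2 h3 ih =>
    obtain ⟨c, t, h0, hn, hc, ht, hj⟩ := ih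
    obtain ⟨c', t', h0', hn', hc', ht', hj'⟩ :=
      extend _ c t false s _ hc ht hj h3 (by simpa [hn] using h2)
    rw [← Nat.add_assoc]
    exact ⟨c', t', h0'.trans h0, hn', hc', ht', by simpa using hj'⟩

end Reach

end Chains

section Generation

variable {F A : Type*} [Field F] [CharP F 2] [DivisionRing A] [Algebra F A] {x y z u : A}

/-- The standard basis of the quaternion algebra generated by `x` and `y`. -/
def pairBasis (x y : A) : Fin 4 → A := ![1, x, y, x * y]

theorem commute_pairBasis {w : A} (hx : Commute w x) (hy : Commute w y) (i : Fin 4) :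
    Commute w (pairBasis x y i) := by
  fin_cases i
  exacts [Commute.one_right w, hx, hy, hx.mul_right hy]

theorem linearIndependent_monomials (h : IsQuadruple F (x, y, z, u)) :
    LinearIndependent F
      fun ij : Fin 4 × Fin 4 => pairBasis x y ij.1 * pairBasis z u ij.2 := by
  obtain ⟨hxy, hzu, hxz, hxu, hyz, hyu⟩ := isQuadruple_iff.mp h
  rw [Fintype.linearIndependent_iff]
  intro g hg
  let d : Fin 4 → A := fun i => ∑ j, g (i, j) • pairBasis z u j
  have hd : ∀ w : A, Commute w z → Commute w u → ∀ i, d i * w = w * d i := by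
    intro w hz hu i
    exact (Commute.sum_right _ _ _ fun j _ =>
      (commute_pairBasis hz hu j).smul_right (g (i, j))).eq.symm
  have hsum : ∑ i, pairBasis x y i * d i = 0 := by
    rw [← hg, Fintype.sum_prod_type]
    simp only [d, Finset.mul_sum, mul_smul_comm]
  have hd0 : ∀ i, d i = 0 := by
    have h4 := hxy.coeff_eq_zero (hd x hxz hxu 0) (hd y hyz hyu 0) (hd x hxz hxu 1)
      (hd y hyz hyu 1) (hd x hxz hxu 2) (hd y hyz hyu 2) (hd x hxz hxu 3) (hd y hyz hyu 3)
      (by simpa [Fin.sum_univ_four, pairBasis] using hsum)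
    intro i
    fin_cases i
    exacts [h4.1, h4.2.1, h4.2.2.1, h4.2.2.2]
  rintro ⟨i, j⟩
  have hi := hd0 i
  have hs : ∀ (c : F) (w : A), c • (1 : A) * w = w * c • (1 : A) := by simp
  have h4 := hzu.coeff_eq_zero (hs (g (i, 0)) z) (hs _ u) (hs (g (i, 1)) z) (hs _ u)
    (hs (g (i, 2)) z) (hs _ u) (hs (g (i, 3)) z) (hs _ u)
    (by simpa [d, Fin.sum_univ_four, pairBasis] using hi)
  simp only [smul_eq_zero, one_ne_zero, or_false] at h4
  fin_cases j
  exacts [h4.1, h4.2.1, h4.2.2.1, h4.2.2.2]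

theorem mem_of_monomials_mem (hdim : Module.finrank F A = 16) (h : IsQuadruple F (x, y, z, u))
    {S : Submodule F A} (hS : ∀ i j, pairBasis x y i * pairBasis z u j ∈ S) (w : A) :
    w ∈ S := by
  have : FiniteDimensional F A := .of_finrank_pos (by simp [hdim])
  have htop := (linearIndependent_monomials h).span_eq_top_of_card_eq_finrank' (by simp [hdim])
  have hle : (⊤ : Submodule F A) ≤ S := by
    rw [← htop, Submodule.span_le]
    rintro _ ⟨ij, rfl⟩
    exact hS ij.1 ij.2
  exact hle Submodule.mem_top

theorem mem_subalgebra_of_generators_mem (hdim : Module.finrank F A = 16)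
    (h : IsQuadruple F (x, y, z, u)) {S : Subalgebra F A} (hx : x ∈ S) (hy : y ∈ S) (hz : z ∈ S)
    (hu : u ∈ S) (w : A) : w ∈ S := by
  have key : ∀ {x y : A}, x ∈ S → y ∈ S → ∀ i, pairBasis x y i ∈ S := by
    intro x y hx hy i
    fin_cases i
    exacts [S.one_mem, hx, hy, S.mul_mem hx hy]
  exact mem_of_monomials_mem hdim h (S := Subalgebra.toSubmodule S)
    (fun i j => S.mul_mem (key hx hy i) (key hz hu j)) w

theorem exists_eq_smul_one_of_commute (hcentral : Subalgebra.center F A = ⊥)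
    (hdim : Module.finrank F A = 16) (h : IsQuadruple F (x, y, z, u)) {w : A}
    (hx : w * x = x * w) (hy : w * y = y * w) (hz : w * z = z * w) (hu : w * u = u * w) :
    ∃ c : F, w = c • (1 : A) := by
  have hw : w ∈ Subalgebra.center F A := by
    rw [Subalgebra.mem_center_iff]
    intro b
    have hS : ∀ v, v * w = w * v → v ∈ Subalgebra.centralizer F {w} := by
      intro v hv
      rw [Subalgebra.mem_centralizer_iff]
      rintro _ rfl
      exact hv.symm
    have := mem_subalgebra_of_generators_mem hdim h (hS x hx.symm) (hS y hy.symm) (hS z hz.symm)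
      (hS u hu.symm) b
    rw [Subalgebra.mem_centralizer_iff] at this
    exact (this w rfl).symm
  rw [hcentral, Algebra.mem_bot] at hw
  obtain ⟨c, rfl⟩ := hw
  exact ⟨c, Algebra.algebraMap_eq_smul_one c⟩

end Generation

section Involutions

variable {F A : Type*} [Field F] [CharP F 2] [DivisionRing A] [Algebra F A] {x y z u : A}

/-- `T` is an `F`-linear involution. -/
structure IsInvolution (T : A →ₗ[F] A) : Prop where
  map_mul : ∀ v w, T (v * w) = T w * T v
  map_map : ∀ w, T (T w) = w

theorem IsInvolution.map_one {T : A →ₗ[F] A} (h : IsInvolution T) : T 1 = 1 := by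
  have := h.map_mul 1 (T 1)
  simpa [h.map_map] using this.symm

/-- `T` restricts to the canonical involutions, up to the normalization `x ↦ x + 1`, `y ↦ y`, on
the two quaternion algebras of a quadruple. -/
def IsAdapted (T : A →ₗ[F] A) (q : A × A × A × A) : Prop :=
  T q.1 = q.1 + 1 ∧ T q.2.1 = q.2.1 ∧ T q.2.2.1 = q.2.2.1 + 1 ∧ T q.2.2.2 = q.2.2.2

theorem QPair.exists_partial_involution (h : QPair F x y) :
    ∃ T : A →ₗ[F] A, T 1 = 1 ∧ (∀ w, T (w * x) = (x + 1) * T w) ∧ (∀ w, T (w * y) = y * T w) ∧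
      ∀ c, Commute c x → Commute c y → ∀ w, T (w * c) = T w * c ∧ T (c * w) = c * T w := by
  have := charP_two_of_algebra F (A := A)
  obtain ⟨hne, ⟨α, hα⟩, ⟨β, hβ⟩, hr⟩ := h
  have hβ0 := ne_zero_of_mul_self_eq_smul hne hβ
  have hα' : ∀ w, x * (x * w) = x * w + α • w := fun w => by
    rw [← mul_assoc, hα, add_mul, smul_mul_assoc, one_mul]
  have hβ' : ∀ w, y * (y * w) = β • w := fun w => by
    rw [← mul_assoc, hβ, smul_mul_assoc, one_mul]
  have hr' : ∀ w, y * (x * w) = x * (y * w) + y * w := fun w => by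
    rw [← mul_assoc, hr, add_mul, mul_assoc]
  let T : A →ₗ[F] A :=
    { toFun := fun w => x * w + w * x + β⁻¹ • (y * (w + x * w + w * x) * y)
      map_add' := fun v w => by
        simp only [mul_add, add_mul, smul_add, mul_assoc]
        abel
      map_smul' := fun c w => by
        simp only [mul_add, add_mul, smul_add, mul_assoc, smul_mul_assoc, mul_smul_comm,
          RingHom.id_apply, smul_comm c β⁻¹] }
  have hT : ∀ w, T w = x * w + w * x + β⁻¹ • (y * (w + x * w + w * x) * y) := fun w => rfl
  refine ⟨T, ?_, ?_, ?_, ?_⟩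
  · simp only [hT, mul_add, add_mul, mul_assoc, smul_add, smul_smul, mul_one, one_mul, hr, hr', hβ,
      hβ', mul_smul_comm, smul_mul_assoc]
    clear hr hr' hα hα' hβ hβ' hT
    match_scalars <;> field_simp <;> grind
  · intro w
    simp only [hT, mul_add, add_mul, mul_assoc, smul_add, smul_smul, mul_one, one_mul, hr, hr', hβ,
      hβ', hα, hα', mul_smul_comm, smul_mul_assoc]
    clear hr hr' hα hα' hβ hβ' hT
    match_scalars <;> field_simp <;> grind
  · intro w
    simp only [hT, mul_add, add_mul, mul_assoc, smul_add, smul_smul, mul_one, one_mul, hr, hr', hβ,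
      hβ', hα, hα', mul_smul_comm, smul_mul_assoc]
    clear hr hr' hα hα' hβ hβ' hT
    match_scalars <;> field_simp <;> grind
  · intro c hx hy w
    have hx' : ∀ w, x * (c * w) = c * (x * w) := fun w => by
      rw [← mul_assoc, ← hx.eq, mul_assoc]
    have hy' : ∀ w, y * (c * w) = c * (y * w) := fun w => by
      rw [← mul_assoc, ← hy.eq, mul_assoc]
    constructor <;> simp only [hT, mul_add, add_mul, mul_assoc, smul_add, hx', hy', hx.eq, hy.eq,
      smul_mul_assoc, mul_smul_comm]

theorem exists_involution (hdim : Module.finrank F A = 16) (h : IsQuadruple F (x, y, z, u)) :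
    ∃ T : A →ₗ[F] A, IsInvolution T ∧ IsAdapted T (x, y, z, u) := by
  have := charP_two_of_algebra F (A := A)
  obtain ⟨hxy, hzu, hxz, hxu, hyz, hyu⟩ := isQuadruple_iff.mp h
  obtain ⟨T₁, h1, hx, hy, hc⟩ := hxy.exists_partial_involution
  obtain ⟨T₂, h1', hz, hu, hc'⟩ := hzu.exists_partial_involution
  let T : A →ₗ[F] A := T₂ ∘ₗ T₁
  have hT1 : T 1 = 1 := by simp [T, h1, h1']
  have hTx : ∀ w, T (w * x) = (x + 1) * T w := fun w => by
    simp only [T, LinearMap.comp_apply, hx]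
    exact (hc' (x + 1) (Commute.add_left hxz (Commute.one_left z))
      (Commute.add_left hxu (Commute.one_left u)) _).2
  have hTy : ∀ w, T (w * y) = y * T w := fun w => by
    simp only [T, LinearMap.comp_apply, hy]
    exact (hc' y hyz hyu _).2
  have hTz : ∀ w, T (w * z) = (z + 1) * T w := fun w => by
    simp only [T, LinearMap.comp_apply, (hc z hxz.symm hyz.symm w).1, hz]
  have hTu : ∀ w, T (w * u) = u * T w := fun w => by
    simp only [T, LinearMap.comp_apply, (hc u hxu.symm hyu.symm w).1, hu]
  have hx0 : T x = x + 1 := by simpa [hT1] using hTx 1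
  have hy0 : T y = y := by simpa [hT1] using hTy 1
  have hz0 : T z = z + 1 := by simpa [hT1] using hTz 1
  have hu0 : T u = u := by simpa [hT1] using hTu 1
  let S : Subalgebra F A :=
    { carrier := {b | ∀ a, T (a * b) = T b * T a}
      mul_mem' := fun {b c} hb hc a => by rw [← mul_assoc, hc, hb, hc b, mul_assoc]
      add_mem' := fun {b c} hb hc a => by rw [mul_add, map_add, map_add, hb, hc, add_mul]
      algebraMap_mem' := fun r a => by simp [Algebra.algebraMap_eq_smul_one, hT1] }
  have hmul : ∀ a b, T (a * b) = T b * T a := fun a b =>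
    mem_subalgebra_of_generators_mem hdim h (S := S)
      (fun a => by rw [hTx, hx0]) (fun a => by rw [hTy, hy0])
      (fun a => by rw [hTz, hz0]) (fun a => by rw [hTu, hu0]) b a
  let S' : Subalgebra F A :=
    { carrier := {b | T (T b) = b}
      mul_mem' := fun {b c} (hb : T (T b) = b) (hc : T (T c) = c) =>
        show T (T (b * c)) = b * c by rw [hmul, hmul, hb, hc]
      add_mem' := fun {b c} (hb : T (T b) = b) (hc : T (T c) = c) =>
        show T (T (b + c)) = b + c by rw [map_add, map_add, hb, hc]
      algebraMap_mem' := fun r => by simp [Algebra.algebraMap_eq_smul_one, hT1] }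
  have hS' : ∀ w, T w = w + 1 → T (T w) = w := fun w hw => by
    rw [hw, map_add, hT1, hw]; grind
  refine ⟨T, ⟨hmul, fun b => mem_subalgebra_of_generators_mem hdim h (S := S') (hS' x hx0) ?_
    (hS' z hz0) ?_ b⟩, hx0, hy0, hz0, hu0⟩
  · exact (congrArg T hy0).trans hy0
  · exact (congrArg T hu0).trans hu0

end Involutions

section Intertwiner

variable {F A : Type*} [Field F] [CharP F 2] [DivisionRing A] [Algebra F A] {x y z u : A}

theorem QPair.exists_intertwine {X b : A} {α : F} (h : QPair F x y) (hα : x * x = x + α • (1 : A))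
    (hX : X * X = X + α • (1 : A)) (hb : b ≠ 0) :
    ∃ b' ≠ 0, X * b' = b' * x ∧ ∀ W w : A, W * X = X * W → w * x = x * w → w * y = y * w →
      W * b = b * w → W * b' = b' * w := by
  have := charP_two_of_algebra F (A := A)
  by_cases h0 : X * b + b * x + b = 0
  · have hXb : X * b = b * x + b := by
      linear_combination (norm := skip) h0
      grind
    refine ⟨b * y, mul_ne_zero hb h.ne, ?_, fun W w _ _ hwy hW => ?_⟩
    · rw [← mul_assoc, hXb, mul_assoc b y x, h.rel, mul_add, add_mul, mul_assoc]
    · rw [← mul_assoc, hW, mul_assoc, hwy, mul_assoc]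
  · refine ⟨_, h0, ?_, fun W w hWX hwx _ hW => ?_⟩
    · have e1 : X * (X * b + b * x + b) = X * X * b + X * b * x + X * b := by
        simp only [mul_add, mul_assoc]
      have e2 : (X * b + b * x + b) * x = X * b * x + b * (x * x) + b * x := by
        simp only [add_mul, mul_assoc]
      rw [e1, e2, hX, hα]
      simp only [add_mul, mul_add, smul_mul_assoc, mul_smul_comm, one_mul, mul_one]
      grind
    · linear_combination (norm := skip) hWX * b + X * hW + hW * x + b * hwx + hW
      grind

theorem exists_intertwine_of_mul_self {y Y b : A} {β : F} (hβ0 : β ≠ 0)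
    (hβ : y * y = β • (1 : A)) (hY : Y * Y = β • (1 : A)) (hb : b ≠ 0) :
    ∃ b' ≠ 0, Y * b' = b' * y ∧ ∀ (W w : A) (k : F), Y * W = W * Y + k • Y →
      y * w = w * y + k • y → W * b = b * w → W * b' = b' * w := by
  have := charP_two_of_algebra F (A := A)
  by_cases h0 : Y * b * y + β • b = 0
  · have hYb : Y * b = b * y := by
      have h1 : β • (Y * b + b * y) = 0 := by
        have h2 := congrArg (· * y) h0
        simp only [add_mul, mul_assoc, hβ, mul_smul_comm, smul_mul_assoc, mul_one, zero_mul] at h2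
        rw [smul_add, h2]
      have h3 := (smul_eq_zero.mp h1).resolve_left hβ0
      linear_combination (norm := skip) h3
      grind
    exact ⟨b, hb, hYb, fun _ _ _ _ _ h => h⟩
  · refine ⟨_, h0, ?_, fun W w k hWY hwy hW => ?_⟩
    · have e1 : Y * (Y * b * y + β • b) = Y * Y * b * y + β • (Y * b) := by
        simp only [mul_add, mul_assoc, mul_smul_comm]
      have e2 : (Y * b * y + β • b) * y = Y * b * (y * y) + β • (b * y) := by
        simp only [add_mul, mul_assoc, smul_mul_assoc]
      rw [e1, e2, hY, hβ]
      simp only [smul_mul_assoc, mul_smul_comm, one_mul, mul_one]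
      exact add_comm _ _
    · have e1 : W * Y = Y * W + k • Y := by rw [hWY]; grind
      have e2 : W * (Y * b * y + β • b) = W * Y * b * y + β • (W * b) := by
        simp only [mul_add, mul_assoc, mul_smul_comm]
      have e3 : (Y * b * y + β • b) * w = Y * b * (y * w) + β • (b * w) := by
        simp only [add_mul, mul_assoc, smul_mul_assoc]
      have e4 : Y * (W * b) * y = Y * (b * w) * y := by rw [hW]
      rw [e2, e3, e1, hwy, hW]
      simp only [add_mul, mul_add, smul_mul_assoc, mul_smul_comm, mul_assoc] at e4 ⊢
      rw [e4]

theorem exists_intertwiner (hdim : Module.finrank F A = 16) (h : IsQuadruple F (x, y, z, u))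
    {T T' : A →ₗ[F] A} (hT : IsInvolution T) (hTq : IsAdapted T (x, y, z, u))
    (hT' : IsInvolution T') : ∃ a : A, a ≠ 0 ∧ ∀ w, a * T w = T' w * a := by
  have := charP_two_of_algebra F (A := A)
  obtain ⟨hxy, hzu, hxz, hxu, hyz, hyu⟩ := isQuadruple_iff.mp h
  obtain ⟨hTx, hTy, hTz, hTu⟩ := hTq
  simp only at hTx hTy hTz hTu
  have has : ∀ {v : A} {α : F}, v * v = v + α • (1 : A) →
      (T' v + 1) * (T' v + 1) = T' v + 1 + α • (1 : A) := by
    intro v α hv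
    have h1 : T' v * T' v = T' v + α • (1 : A) := by
      rw [← hT'.map_mul, hv, map_add, map_smul, hT'.map_one]
    simp only [add_mul, mul_add, one_mul, mul_one, h1]
    grind
  have hsc : ∀ {v : A} {β : F}, v * v = β • (1 : A) → T' v * T' v = β • (1 : A) := by
    intro v β hv
    rw [← hT'.map_mul, hv, map_smul, hT'.map_one]
  have hcomm : ∀ {v w : A}, v * w = w * v → T' v * T' w = T' w * T' v := by
    intro v w hvw
    rw [← hT'.map_mul, ← hT'.map_mul, hvw]
  have hrel : ∀ {v w : A}, QPair F v w → T' w * (T' v + 1) = (T' v + 1) * T' w + T' w := by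
    intro v w hvw
    have h1 : T' v * T' w = T' w * T' v + T' w := by
      rw [← hT'.map_mul, ← hT'.map_mul, ← map_add, hvw.rel]
    simp only [mul_add, add_mul, mul_one, one_mul, h1]
    grind
  obtain ⟨α, hα⟩ := hxy.artinSchreier
  obtain ⟨β, hβ⟩ := hxy.squareCentral
  obtain ⟨γ, hγ⟩ := hzu.artinSchreier
  obtain ⟨δ, hδ⟩ := hzu.squareCentral
  obtain ⟨b₁, hb₁, hX₁, -⟩ := hxy.exists_intertwine hα (has hα) one_ne_zero
  obtain ⟨b₂, hb₂, hZ₂, hW₂⟩ := hzu.exists_intertwine hγ (has hγ) hb₁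
  have hX₂ := hW₂ (T' x + 1) x
    (by simp only [add_mul, mul_add, one_mul, mul_one, hcomm hxz]; abel) hxz hxu hX₁
  obtain ⟨b₃, hb₃, hY₃, hW₃⟩ := exists_intertwine_of_mul_self
    (ne_zero_of_mul_self_eq_smul hxy.ne hβ) hβ (hsc hβ) hb₂
  have hX₃ := hW₃ (T' x + 1) x 1 (by rw [one_smul, hrel hxy]) (by rw [one_smul, hxy.rel]) hX₂
  have hZ₃ := hW₃ (T' z + 1) z 0
    (by simp only [add_mul, mul_add, one_mul, mul_one, hcomm hyz, zero_smul, add_zero])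
    (by rw [hyz, zero_smul, add_zero]) hZ₂
  obtain ⟨b₄, hb₄, hU₄, hW₄⟩ := exists_intertwine_of_mul_self
    (ne_zero_of_mul_self_eq_smul hzu.ne hδ) hδ (hsc hδ) hb₃
  have hX₄ := hW₄ (T' x + 1) x 0
    (by simp only [add_mul, mul_add, one_mul, mul_one, hcomm hxu, zero_smul, add_zero])
    (by rw [hxu, zero_smul, add_zero]) hX₃
  have hZ₄ := hW₄ (T' z + 1) z 1 (by rw [one_smul, hrel hzu]) (by rw [one_smul, hzu.rel]) hZ₃
  have hY₄ := hW₄ (T' y) y 0 (by rw [zero_smul, add_zero, hcomm hyu])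
    (by rw [zero_smul, add_zero, hyu]) hY₃
  let S : Subalgebra F A :=
    { carrier := {w | b₄ * T w = T' w * b₄}
      mul_mem' := fun {v w} (hv : b₄ * T v = T' v * b₄) (hw : b₄ * T w = T' w * b₄) =>
        show b₄ * T (v * w) = T' (v * w) * b₄ by
          rw [hT.map_mul, hT'.map_mul, ← mul_assoc, hw, mul_assoc, hv, mul_assoc]
      add_mem' := fun {v w} (hv : b₄ * T v = T' v * b₄) (hw : b₄ * T w = T' w * b₄) =>
        show b₄ * T (v + w) = T' (v + w) * b₄ by
          rw [map_add, map_add, mul_add, add_mul, hv, hw]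
      algebraMap_mem' := fun r => by
        simp [Algebra.algebraMap_eq_smul_one, hT.map_one, hT'.map_one] }
  have hS : ∀ w, T w = w + 1 → (T' w + 1) * b₄ = b₄ * w → b₄ * T w = T' w * b₄ := by
    intro w hw hb
    rw [hw, mul_add, ← hb, mul_one, add_mul, one_mul, add_assoc]
    grind
  exact ⟨b₄, hb₄, mem_subalgebra_of_generators_mem hdim h (S := S) (hS x hTx hX₄)
    (show b₄ * T y = T' y * b₄ by rw [hTy, hY₄]) (hS z hTz hZ₄)
    (show b₄ * T u = T' u * b₄ by rw [hTu, hU₄])⟩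

theorem IsInvolution.map_intertwiner (hcentral : Subalgebra.center F A = ⊥) {T T' : A →ₗ[F] A}
    (hT : IsInvolution T) (hT' : IsInvolution T') {a : A} (ha : a ≠ 0)
    (h : ∀ w, a * T w = T' w * a) : T a = a := by
  have h1 : ∀ w, w * T a = T a * T (T' w) := by
    intro w
    have := congrArg T (h w)
    rwa [hT.map_mul, hT.map_mul, hT.map_map] at this
  have h2 : ∀ w, a * T (T' w) = w * a := fun w => by rw [h, hT'.map_map]
  have hc : T a * a⁻¹ ∈ Subalgebra.center F A := by
    rw [Subalgebra.mem_center_iff]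
    intro w
    have h3 : T (T' w) = a⁻¹ * w * a := by rw [mul_assoc, ← h2, inv_mul_cancel_left₀ ha]
    rw [← mul_assoc, h1, h3]
    simp only [mul_assoc, mul_inv_cancel₀ ha, mul_one]
  rw [hcentral, Algebra.mem_bot] at hc
  obtain ⟨c, hc⟩ := hc
  have h3 : T a = c • a := by
    rw [Algebra.smul_def, hc, inv_mul_cancel_right₀ ha]
  have h4 : (c * c) • a = (1 : F) • a := by
    rw [one_smul, ← smul_smul, ← h3, ← map_smul, ← h3, hT.map_map]
  have h5 : c * c = 1 := smul_left_injective F ha h4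
  have h6 : c = 1 := by
    have : (c + 1) * (c + 1) = 0 := by grind
    have := mul_self_eq_zero.mp this
    grind
  rw [h3, h6, one_smul]

theorem IsInvolution.exists_intertwiner_eq_add {T T' : A →ₗ[F] A}
    (hT : IsInvolution T) {a x' : A} (hx' : T' x' = x' + 1) (h : ∀ w, a * T w = T' w * a)
    (ha : T a = a) : a = x' * a + T (x' * a) := by
  have := charP_two_of_algebra F (A := A)
  rw [hT.map_mul, ha, h, hx', add_mul, one_mul]
  grind

end Intertwiner

section TraceZero

variable {F A : Type*} [Field F] [CharP F 2] [DivisionRing A] [Algebra F A] {x y z u : A}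

/-- The square-central elements attached to a quadruple. -/
def traceZeroSpace (F : Type*) {A : Type*} [Field F] [DivisionRing A] [Algebra F A]
    (q : A × A × A × A) : Submodule F A :=
  Submodule.span F {1, q.2.1, q.1 * q.2.1, q.2.2.2, q.2.2.1 * q.2.2.2}

theorem mem_traceZeroSpace {m : A} : m ∈ traceZeroSpace F (x, y, z, u) ↔
    ∃ c a b d e : F, m = c • (1 : A) + (a • y + b • (x * y)) + (d • u + e • (z * u)) := by
  simp only [traceZeroSpace, Submodule.mem_span_insert, Submodule.mem_span_singleton]
  constructor
  · rintro ⟨c, _, ⟨a, _, ⟨b, _, ⟨d, _, ⟨e, rfl⟩, rfl⟩, rfl⟩, rfl⟩, rfl⟩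
    exact ⟨c, a, b, d, e, by abel⟩
  · rintro ⟨c, a, b, d, e, rfl⟩
    exact ⟨c, _, ⟨a, _, ⟨b, _, ⟨d, _, ⟨e, rfl⟩, rfl⟩, rfl⟩, rfl⟩, by abel⟩

/-- A subspace `M` contains the square-central elements attached to `q`. -/
def ContainsQuadruple (M : Submodule F A) (q : A × A × A × A) : Prop :=
  q.2.1 ∈ M ∧ q.1 * q.2.1 ∈ M ∧ q.2.2.2 ∈ M ∧ q.2.2.1 * q.2.2.2 ∈ M

theorem containsQuadruple_traceZeroSpace (q : A × A × A × A) :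
    ContainsQuadruple (traceZeroSpace F q) q := by
  refine ⟨?_, ?_, ?_, ?_⟩ <;> exact Submodule.subset_span (by simp)

theorem ContainsQuadruple.swap {M : Submodule F A} (h : ContainsQuadruple M (x, y, z, u)) :
    ContainsQuadruple M (z, u, x, y) :=
  ⟨h.2.2.1, h.2.2.2, h.1, h.2.1⟩

theorem QPair.mul_self_plane (h : QPair F x y) (a b : F) :
    ∃ γ : F, (a • y + b • (x * y)) * (a • y + b • (x * y)) = γ • (1 : A) := by
  by_cases h0 : a • y + b • (x * y) = 0
  · exact ⟨0, by rw [h0, zero_smul, zero_mul]⟩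
  · exact (h.of_plane a b h0).squareCentral

theorem IsQuadruple.plane_mul_plane (h : IsQuadruple F (x, y, z, u)) (a b d e : F) :
    (a • y + b • (x * y)) * (d • u + e • (z * u)) =
      (d • u + e • (z * u)) * (a • y + b • (x * y)) := by
  obtain ⟨-, -, hxz, hxu, hyz, hyu⟩ := isQuadruple_iff.mp h
  have hcomm : ∀ w, Commute x w → Commute y w → Commute (a • y + b • (x * y)) w :=
    fun w hxw hyw => (hyw.smul_left a).add_left ((hxw.mul_left hyw).smul_left b)
  have hu := hcomm u hxu hyu
  have hz := hcomm z hxz hyz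
  exact ((hu.smul_right d).add_right ((hz.mul_right hu).smul_right e)).eq

theorem IsQuadruple.mul_self_of_mem_traceZeroSpace (h : IsQuadruple F (x, y, z, u)) {m : A}
    (hm : m ∈ traceZeroSpace F (x, y, z, u)) : ∃ γ : F, m * m = γ • (1 : A) := by
  have := charP_two_of_algebra F (A := A)
  obtain ⟨hxy, hzu, -⟩ := isQuadruple_iff.mp h
  obtain ⟨c, a, b, d, e, rfl⟩ := mem_traceZeroSpace.mp hm
  obtain ⟨γ, hγ⟩ := hxy.mul_self_plane a b
  obtain ⟨δ, hδ⟩ := hzu.mul_self_plane d e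
  have hc := h.plane_mul_plane a b d e
  generalize a • y + b • (x * y) = p at *
  generalize d • u + e • (z * u) = q at *
  refine ⟨c ^ 2 + γ + δ, ?_⟩
  simp only [mul_add, add_mul, smul_mul_assoc, mul_smul_comm, mul_one, one_mul, hγ, hδ, hc,
    smul_add, smul_smul, add_smul, pow_two]
  grind

theorem IsQuadruple.add_mul_of_mem_traceZeroSpace (h : IsQuadruple F (x, y, z, u)) {m : A}
    (hm : m ∈ traceZeroSpace F (x, y, z, u)) :
    ∃ γ : F, (x + z) * m + m * (x + z) = m + γ • (1 : A) := by
  obtain ⟨⟨-, -, -, hr⟩, ⟨-, -, -, hr'⟩, hxz, hxu, hyz, hyu⟩ := isQuadruple_iff.mp h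
  have e7 : ∀ w, z * (x * w) = x * (z * w) := fun w => by
    rw [← mul_assoc, ← hxz, mul_assoc]
  obtain ⟨c, a, b, d, e, rfl⟩ := mem_traceZeroSpace.mp hm
  refine ⟨c, ?_⟩
  simp only [mul_add, add_mul, mul_assoc, smul_add, smul_smul, mul_one, one_mul, mul_smul_comm,
    smul_mul_assoc, hr, hr', ← hyz, ← hxu, e7]
  match_scalars <;> grind

theorem IsQuadruple.not_eq_smul_one_of_anticomm {v w : A} (h : v * w ≠ w * v) (c : F) :
    v ≠ c • (1 : A) := by
  rintro rfl
  simp at h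

theorem IsAdapted.exists_add_map_eq (hdim : Module.finrank F A = 16)
    (h : IsQuadruple F (x, y, z, u)) {T : A →ₗ[F] A} (hT : IsInvolution T)
    (hTq : IsAdapted T (x, y, z, u)) (w : A) :
    ∃ t : F, ∃ m ∈ traceZeroSpace F (x, y, z, u), w + T w = t • (x + z) + m := by
  have := charP_two_of_algebra F (A := A)
  obtain ⟨hxy, hzu, hxz, hxu, hyz, hyu⟩ := isQuadruple_iff.mp h
  obtain ⟨hTx, hTy, hTz, hTu⟩ := hTq
  simp only at hTx hTy hTz hTu
  let V : Submodule F A := Submodule.span F {x + z} ⊔ traceZeroSpace F (x, y, z, u)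
  have hV1 : (1 : A) ∈ V := Submodule.mem_sup_right (Submodule.subset_span (by simp))
  have hVs : x + z ∈ V := Submodule.mem_sup_left (Submodule.mem_span_singleton_self _)
  obtain ⟨hVy, hVxy, hVu, hVzu⟩ := containsQuadruple_traceZeroSpace (F := F) (x, y, z, u)
  replace hVy : y ∈ V := Submodule.mem_sup_right hVy
  replace hVxy : x * y ∈ V := Submodule.mem_sup_right hVxy
  replace hVu : u ∈ V := Submodule.mem_sup_right hVu
  replace hVzu : z * u ∈ V := Submodule.mem_sup_right hVzu
  suffices hw : w + T w ∈ V by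
    obtain ⟨_, hs, m, hm, hsm⟩ := Submodule.mem_sup.mp hw
    obtain ⟨t, rfl⟩ := Submodule.mem_span_singleton.mp hs
    exact ⟨t, m, hm, hsm.symm⟩
  let ε : Fin 4 → A := ![0, 1, 0, 0]
  have hε : ∀ {x y : A}, QPair F x y → T x = x + 1 → T y = y → ∀ i,
      T (pairBasis x y i) = pairBasis x y i + ε i := by
    intro x y hxy hx hy i
    fin_cases i
    · simpa [pairBasis, ε] using hT.map_one
    · simpa [pairBasis, ε] using hx
    · simpa [pairBasis, ε] using hy
    · simp only [pairBasis, ε, hT.map_mul, hx, hy, Fin.reduceFinMk, Matrix.cons_val, mul_add,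
        mul_one, hxy.rel, add_zero]
      grind
  refine mem_of_monomials_mem hdim h (S := V.comap (LinearMap.id + T)) (fun i j => ?_) w
  have hij : pairBasis x y i * pairBasis z u j = pairBasis z u j * pairBasis x y i :=
    ((commute_pairBasis (commute_pairBasis hxz hxu j).symm
      (commute_pairBasis hyz hyu j).symm i).symm.eq)
  have key : (LinearMap.id + T : A →ₗ[F] A) (pairBasis x y i * pairBasis z u j) =
      ε i * pairBasis z u j + pairBasis x y i * ε j + ε i * ε j := by
    simp only [LinearMap.add_apply, LinearMap.id_apply, hT.map_mul, hε hxy hTx hTy,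
      hε hzu hTz hTu, add_mul, mul_add, hij]
    grind
  rw [Submodule.mem_comap, key]
  have hVz : z + x + 1 ∈ V := by rw [add_comm z x]; exact V.add_mem hVs hV1
  fin_cases i <;> fin_cases j <;>
    simp [pairBasis, ε, hV1, hVy, hVxy, hVu, hVzu, hVz]

theorem IsInvolution.map_of_mem_traceZeroSpace {T : A →ₗ[F] A} (hT : IsInvolution T)
    (h : IsQuadruple F (x, y, z, u)) (hTq : IsAdapted T (x, y, z, u)) {m : A}
    (hm : m ∈ traceZeroSpace F (x, y, z, u)) : T m = m := by
  have := charP_two_of_algebra F (A := A)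
  obtain ⟨hxy, hzu, -⟩ := isQuadruple_iff.mp h
  obtain ⟨hTx, hTy, hTz, hTu⟩ := hTq
  simp only at hTx hTy hTz hTu
  obtain ⟨c, a, b, d, e, rfl⟩ := mem_traceZeroSpace.mp hm
  have h1 : y * (x + 1) = x * y := by rw [mul_add, hxy.rel, mul_one]; grind
  have h2 : u * (z + 1) = z * u := by rw [mul_add, hzu.rel, mul_one]; grind
  simp only [map_add, map_smul, hT.map_one, hT.map_mul, hTx, hTy, hTz, hTu, h1, h2]

theorem ContainsQuadruple.isAdapted {T : A →ₗ[F] A} (hT : IsInvolution T)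
    (h : IsQuadruple F (x, y, z, u)) {M : Submodule F A} (hM : ∀ m ∈ M, T m = m)
    (hq : ContainsQuadruple M (x, y, z, u)) : IsAdapted T (x, y, z, u) := by
  have := charP_two_of_algebra F (A := A)
  obtain ⟨hxy, hzu, -⟩ := isQuadruple_iff.mp h
  have key : ∀ {x y : A}, QPair F x y → y ∈ M → x * y ∈ M → T x = x + 1 := by
    intro x y hxy hy hxy'
    have h1 := hM _ hxy'
    rw [hT.map_mul, hM _ hy] at h1
    refine mul_left_cancel₀ hxy.ne ?_
    rw [h1, mul_add, hxy.rel, mul_one]; grind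
  exact ⟨key hxy hq.1 hq.2.1, hM _ hq.1, key hzu hq.2.2.1 hq.2.2.2, hM _ hq.2.2.1⟩

theorem IsAdapted.containsQuadruple (hdim : Module.finrank F A = 16) {x' y' z' u' : A}
    (h : IsQuadruple F (x, y, z, u)) (h' : IsQuadruple F (x', y', z', u')) {T : A →ₗ[F] A}
    (hT : IsInvolution T) (hTq : IsAdapted T (x, y, z, u)) (hTq' : IsAdapted T (x', y', z', u')) :
    ContainsQuadruple (traceZeroSpace F (x', y', z', u')) (x, y, z, u) := by
  have := charP_two_of_algebra F (A := A)
  obtain ⟨hxy, hzu, hxz, hxu, hyz, hyu⟩ := isQuadruple_iff.mp h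
  obtain ⟨hxy', hzu', hxz', -⟩ := isQuadruple_iff.mp h'
  obtain ⟨α, hα⟩ := hxy'.artinSchreier
  obtain ⟨γ, hγ⟩ := hzu'.artinSchreier
  have hM : ∀ v w m : A, v * w ≠ w * v → (∃ c : F, v * v = c • (1 : A)) → v = m + T m →
      v ∈ traceZeroSpace F (x', y', z', u') := by
    rintro v w m hvw ⟨c, hc⟩ hv
    obtain ⟨t, m', hm', hv'⟩ := hTq'.exists_add_map_eq hdim h' hT m
    rw [← hv] at hv'
    obtain ⟨c₁, hc₁⟩ := h'.mul_self_of_mem_traceZeroSpace hm'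
    obtain ⟨c₂, hc₂⟩ := h'.add_mul_of_mem_traceZeroSpace hm'
    have hs : (x' + z') * (x' + z') = (x' + z') + (α + γ) • (1 : A) := by
      simp only [add_mul, mul_add, hα, hγ, hxz', add_smul]
      grind
    have key : t • v = (c + c₁ + t * c₂ + t ^ 2 * (α + γ)) • (1 : A) := by
      have h1 : v * v = (t ^ 2) • ((x' + z') * (x' + z')) +
          t • ((x' + z') * m' + m' * (x' + z')) + m' * m' := by
        rw [hv']
        generalize x' + z' = s
        simp only [mul_add, add_mul, smul_mul_assoc, mul_smul_comm]
        module
      rw [hc, hs, hc₁, hc₂] at h1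
      rw [hv']
      generalize x' + z' = s at *
      have h2 : t • (t • s + m') + ((c + c₁ + t * c₂ + t ^ 2 * (α + γ)) • (1 : A)) =
          c • (1 : A) + (t ^ 2 • (s + (α + γ) • 1) + t • (m' + c₂ • 1) + c₁ • 1) := by
        module
      rw [← h1, CharTwo.add_self_eq_zero] at h2
      exact CharTwo.add_eq_zero.mp h2
    have ht : t = 0 := by
      by_contra ht
      refine IsQuadruple.not_eq_smul_one_of_anticomm hvw
        (t⁻¹ * (c + c₁ + t * c₂ + t ^ 2 * (α + γ))) ?_
      rw [← smul_smul, ← key, smul_smul, inv_mul_cancel₀ ht, one_smul]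
    rw [hv', ht, zero_smul, zero_add]
    exact hm'
  have hne : ∀ {x y : A}, QPair F x y → y * x ≠ x * y ∧ y * (x * y) ≠ x * y * y := by
    intro x y hxy
    have h1 : y * x ≠ x * y := by
      rw [hxy.rel]
      simpa using hxy.ne
    refine ⟨h1, fun h2 => h1 (mul_right_cancel₀ hxy.ne ?_)⟩
    rw [mul_assoc, h2]
  have hsq : ∀ {x y : A}, QPair F x y → ∃ c : F, x * y * (x * y) = c • (1 : A) := by
    intro x y hxy
    simpa using hxy.mul_self_plane 0 1
  have hTxy : ∀ {x y : A}, QPair F x y → T x = x + 1 → T y = y → T (x * y) = x * y := by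
    intro x y hxy hx hy
    rw [hT.map_mul, hx, hy, mul_add, hxy.rel, mul_one]
    grind
  have hmap : ∀ {z v : A}, T z = z + 1 → T v = v → v * z = z * v → v = z * v + T (z * v) := by
    intro z v hz hv hc
    rw [hT.map_mul, hz, hv, mul_add, hc, mul_one]
    grind
  obtain ⟨hTx, hTy, hTz, hTu⟩ := hTq
  simp only at hTx hTy hTz hTu
  refine ⟨?_, ?_, ?_, ?_⟩
  · exact hM y x (z * y) (hne hxy).1 hxy.squareCentral (hmap hTz hTy hyz)
  · exact hM (x * y) y (z * (x * y)) (hne hxy).2.symm (hsq hxy)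
      (hmap hTz (hTxy hxy hTx hTy) (by rw [mul_assoc, hyz, ← mul_assoc, hxz, mul_assoc]))
  · exact hM u z (x * u) (hne hzu).1 hzu.squareCentral (hmap hTx hTu hxu.symm)
  · exact hM (z * u) u (x * (z * u)) (hne hzu).2.symm (hsq hzu)
      (hmap hTx (hTxy hzu hTz hTu) (by rw [mul_assoc, ← hxu, ← mul_assoc, ← hxz, mul_assoc]))

end TraceZero

section Connectivity

variable {F A : Type*} [Field F] [CharP F 2] [DivisionRing A] [Algebra F A] {x y z u : A}

theorem IsQuadruple.quadSwap (h : IsQuadruple F (x, y, z, u)) : IsQuadruple F (z, u, x, y) := by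
  obtain ⟨hxy, hzu, hxz, hxu, hyz, hyu⟩ := isQuadruple_iff.mp h
  exact isQuadruple_iff.mpr ⟨hzu, hxy, hxz.symm, hyz.symm, hxu.symm, hyu.symm⟩

theorem exists_polar {M : Submodule F A} (hM : ∀ m ∈ M, ∃ γ : F, m * m = γ • (1 : A)) {m n : A}
    (hm : m ∈ M) (hn : n ∈ M) : ∃ γ : F, m * n + n * m = γ • (1 : A) := by
  have := charP_two_of_algebra F (A := A)
  obtain ⟨a, ha⟩ := hM m hm
  obtain ⟨b, hb⟩ := hM n hn
  obtain ⟨c, hc⟩ := hM _ (M.add_mem hm hn)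
  refine ⟨a + b + c, ?_⟩
  rw [add_smul, add_smul, ← ha, ← hb, ← hc]
  grind

theorem QPair.commute_left (h : QPair F x y) {w : A} (hy : w * y = y * w)
    (hxy : w * (x * y) = x * y * w) : w * x = x * w := by
  refine mul_right_cancel₀ h.ne ?_
  rw [mul_assoc, hxy, mul_assoc, ← hy, mul_assoc]

theorem exists_eq_smul_one_of_commute_traceZero (hcentral : Subalgebra.center F A = ⊥)
    (hdim : Module.finrank F A = 16) (h : IsQuadruple F (x, y, z, u)) {w : A}
    (hy : w * y = y * w) (hxy : w * (x * y) = x * y * w) (hu : w * u = u * w)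
    (hzu : w * (z * u) = z * u * w) : ∃ c : F, w = c • (1 : A) := by
  obtain ⟨h1, h2, -⟩ := isQuadruple_iff.mp h
  exact exists_eq_smul_one_of_commute hcentral hdim h (h1.commute_left hy hxy) hy
    (h2.commute_left hu hzu) hu

theorem QPair.polar (h : QPair F x y) {β : F} (hβ : y * y = β • (1 : A)) :
    y * (x * y) + x * y * y = β • (1 : A) := by
  have := charP_two_of_algebra F (A := A)
  rw [← hβ, ← mul_assoc, h.rel]
  grind

theorem ContainsQuadruple.mem_traceZeroSpace (hcentral : Subalgebra.center F A = ⊥)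
    (hdim : Module.finrank F A = 16) (h : IsQuadruple F (x, y, z, u)) {M : Submodule F A}
    (hM : ∀ m ∈ M, ∃ γ : F, m * m = γ • (1 : A)) (hq : ContainsQuadruple M (x, y, z, u)) {m : A}
    (hm : m ∈ M) : m ∈ traceZeroSpace F (x, y, z, u) := by
  have := charP_two_of_algebra F (A := A)
  obtain ⟨hxy, hzu, hxz, hxu, hyz, hyu⟩ := isQuadruple_iff.mp h
  obtain ⟨β, hβ⟩ := hxy.squareCentral
  obtain ⟨δ, hδ⟩ := hzu.squareCentral
  have hβ0 := ne_zero_of_mul_self_eq_smul hxy.ne hβ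
  have hδ0 := ne_zero_of_mul_self_eq_smul hzu.ne hδ
  obtain ⟨hqy, hqe, hqu, hqf⟩ := hq
  simp only at hqy hqe hqu hqf
  obtain ⟨k₁, hk₁⟩ := exists_polar hM hm hqu
  obtain ⟨k₂, hk₂⟩ := exists_polar hM hm hqf
  obtain ⟨k₃, hk₃⟩ := exists_polar hM hm hqy
  obtain ⟨k₄, hk₄⟩ := exists_polar hM hm hqe
  have hp := hxy.polar hβ
  have hp' := hzu.polar hδ
  have hc₁ : y * (z * u) = z * u * y := by rw [← mul_assoc, hyz, mul_assoc, hyu, mul_assoc]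
  have hc₂ : x * y * u = u * (x * y) := by rw [mul_assoc, hyu, ← mul_assoc, hxu, mul_assoc]
  have hc₃ : x * y * (z * u) = z * u * (x * y) := by
    rw [mul_assoc, hc₁, ← mul_assoc, ← mul_assoc, hxz, mul_assoc z, hxu]
    simp only [mul_assoc]
  suffices hw : ∃ c : F, m + (β⁻¹ • (k₄ • y + k₃ • (x * y)) + δ⁻¹ • (k₂ • u + k₁ • (z * u))) =
      c • (1 : A) by
    obtain ⟨c, hc⟩ := hw
    refine _root_.mem_traceZeroSpace.mpr
      ⟨c, β⁻¹ * k₄, β⁻¹ * k₃, δ⁻¹ * k₂, δ⁻¹ * k₁, ?_⟩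
    simp only [← smul_smul, ← smul_add, ← hc]
    grind
  have key : ∀ {w v : A}, w * v + v * w = 0 → w * v = v * w := fun h => CharTwo.add_eq_zero.mp h
  apply exists_eq_smul_one_of_commute_traceZero hcentral hdim h <;> refine key ?_ <;> clear key hM
  · trans (m * y + y * m) + (β⁻¹ * k₃) • (y * (x * y) + x * y * y)
    · simp only [mul_add, add_mul, smul_add, smul_mul_assoc, mul_smul_comm, smul_smul, hyu, hc₁]
      grind
    · rw [hk₃, hp, smul_smul, ← add_smul, mul_right_comm, inv_mul_cancel₀ hβ0,
        one_mul, CharTwo.add_self_eq_zero, zero_smul]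
  · trans (m * (x * y) + x * y * m) + (β⁻¹ * k₄) • (y * (x * y) + x * y * y)
    · simp only [mul_add, add_mul, smul_add, smul_mul_assoc, mul_smul_comm, smul_smul, hc₂, hc₃]
      grind
    · rw [hk₄, hp, smul_smul, ← add_smul, mul_right_comm, inv_mul_cancel₀ hβ0,
        one_mul, CharTwo.add_self_eq_zero, zero_smul]
  · trans (m * u + u * m) + (δ⁻¹ * k₁) • (u * (z * u) + z * u * u)
    · simp only [mul_add, add_mul, smul_add, smul_mul_assoc, mul_smul_comm, smul_smul, hyu, hc₂]
      grind
    · rw [hk₁, hp', smul_smul, ← add_smul, mul_right_comm, inv_mul_cancel₀ hδ0,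
        one_mul, CharTwo.add_self_eq_zero, zero_smul]
  · trans (m * (z * u) + z * u * m) + (δ⁻¹ * k₂) • (u * (z * u) + z * u * u)
    · simp only [mul_add, add_mul, smul_add, smul_mul_assoc, mul_smul_comm, smul_smul, hc₁, hc₃]
      grind
    · rw [hk₂, hp', smul_smul, ← add_smul, mul_right_comm, inv_mul_cancel₀ hδ0,
        one_mul, CharTwo.add_self_eq_zero, zero_smul]

theorem IsQuadruple.omegaI (h : IsQuadruple F (x, y, z, u)) (k : F) :
    IsQuadruple F (x + k • (y * u), y, z + k • (y * u), u) := by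
  have := charP_two_of_algebra F (A := A)
  obtain ⟨⟨hy, ⟨α, hα⟩, ⟨β, hβ⟩, hr⟩, ⟨hu, ⟨γ, hγ⟩, ⟨δ, hδ⟩, hr'⟩, hxz, hxu, hyz, hyu⟩ :=
    isQuadruple_iff.mp h
  have hsq : y * u * (y * u) = (β * δ) • (1 : A) := by
    rw [mul_assoc, ← mul_assoc u, ← hyu, mul_assoc y, hδ, ← mul_assoc, hβ, smul_mul_assoc,
      one_mul, smul_smul]
  have hx : y * u * x = x * (y * u) + y * u := by
    rw [mul_assoc, ← hxu, ← mul_assoc, hr, add_mul, mul_assoc]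
  have hz : y * u * z = z * (y * u) + y * u := by
    rw [mul_assoc, hr', mul_add, ← mul_assoc, hyz, mul_assoc]
  have hyw : y * (y * u) = y * u * y := by rw [mul_assoc, hyu]
  have huw : u * (y * u) = y * u * u := by rw [← mul_assoc, ← hyu]
  generalize hw : y * u = w at *
  refine isQuadruple_iff.mpr ⟨⟨hy, ⟨α + k ^ 2 * (β * δ), ?_⟩, ⟨β, hβ⟩, ?_⟩,
    ⟨hu, ⟨γ + k ^ 2 * (β * δ), ?_⟩, ⟨δ, hδ⟩, ?_⟩, ?_, ?_, ?_, hw.trans hyu⟩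
  · simp only [add_mul, mul_add, smul_mul_assoc, mul_smul_comm, hα, hx, hsq, smul_add, smul_smul]
    match_scalars <;> grind
  · simp only [add_mul, mul_add, smul_mul_assoc, mul_smul_comm, hr, hyw]
    abel
  · simp only [add_mul, mul_add, smul_mul_assoc, mul_smul_comm, hγ, hz, hsq, smul_add, smul_smul]
    match_scalars <;> grind
  · simp only [add_mul, mul_add, smul_mul_assoc, mul_smul_comm, hr', huw]
    abel
  · simp only [add_mul, mul_add, smul_mul_assoc, mul_smul_comm, hxz, hx, hz, hsq, smul_add]
    abel
  · simp only [add_mul, mul_add, smul_mul_assoc, mul_smul_comm, hxu, huw]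
  · simp only [add_mul, mul_add, smul_mul_assoc, mul_smul_comm, hyz, hyw]

/-- Quadruples sharing the first pair are connected by elementary steps. -/
theorem reach_of_share_pair (hcentral : Subalgebra.center F A = ⊥)
    (hdim : Module.finrank F A = 16) {z' u' : A} (h : IsQuadruple F (x, y, z, u))
    (h' : IsQuadruple F (x, y, z', u')) {M : Submodule F A}
    (hM : ∀ m ∈ M, ∃ γ : F, m * m = γ • (1 : A)) (hq : ContainsQuadruple M (x, y, z, u))
    (hu' : u' ∈ M) : Reach F 4 0 (x, y, z, u) (x, y, z', u') := by
  have := charP_two_of_algebra F (A := A)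
  obtain ⟨hxy, hzu, hxz, hxu, hyz, hyu⟩ := isQuadruple_iff.mp h
  obtain ⟨-, hzu', hxz', hxu', hyz', hyu'⟩ := isQuadruple_iff.mp h'
  have key : ∃ v ∈ M, QPair F z v ∧ x * v = v * x ∧ y * v = v * y ∧ v * u' + u' * v ≠ 0 := by
    by_contra! hcon
    have h1 := hcon u hq.2.2.1 hzu hxu hyu
    have h2 := hcon (z * u) hq.2.2.2
      (by simpa using hzu.of_plane 0 1 (by
        simpa using mul_ne_zero (fun h0 => hzu.ne (by simpa [h0] using hzu.rel.symm)) hzu.ne))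
      (by rw [← mul_assoc, hxz, mul_assoc, hxu, mul_assoc])
      (by rw [← mul_assoc, hyz, mul_assoc, hyu, mul_assoc])
    obtain ⟨c, hc⟩ := exists_eq_smul_one_of_commute_traceZero hcentral hdim h hyu'.symm
      (by rw [← mul_assoc, ← hxu', mul_assoc, ← hyu', mul_assoc])
      (CharTwo.add_eq_zero.mp h1).symm (CharTwo.add_eq_zero.mp h2).symm
    have h3 := hzu'.rel
    rw [hc] at h3
    exact hzu'.ne (by rw [hc]; simpa using h3)
  obtain ⟨v, hv, hzv, hxv, hyv, hne⟩ := key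
  obtain ⟨c, hc⟩ := exists_polar hM hv hu'
  have hc0 : c ≠ 0 := by rintro rfl; exact hne (by rw [hc, zero_smul])
  obtain ⟨h1, h2⟩ := QPair.of_anticomm (hM v hv) (hM u' hu') hc0 hc
  have hx0 : x * (c⁻¹ • (v * u')) = (c⁻¹ • (v * u')) * x := by
    rw [mul_smul_comm, smul_mul_assoc, ← mul_assoc, hxv, mul_assoc, hxu', mul_assoc]
  have hy0 : y * (c⁻¹ • (v * u')) = (c⁻¹ • (v * u')) * y := by
    rw [mul_smul_comm, smul_mul_assoc, ← mul_assoc, hyv, mul_assoc, hyu', mul_assoc]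
  refine ((((Reach.refl h).lambda (r := (x, y, z, u)) (s := (x, y, z, v)) ?_ ?_).lambda
    (s := (x, y, c⁻¹ • (v * u'), v)) ?_ ?_).lambda (s := (x, y, c⁻¹ • (v * u'), u')) ?_ ?_).lambda
    ?_ h'
  · exact Or.inl (Or.inl ⟨rfl, rfl, rfl⟩)
  · exact isQuadruple_iff.mpr ⟨hxy, hzv, hxz, hxv, hyz, hyv⟩
  · exact Or.inl (Or.inr (Or.inl ⟨rfl, rfl, rfl⟩))
  · exact isQuadruple_iff.mpr ⟨hxy, h1, hx0, hxv, hy0, hyv⟩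
  · exact Or.inl (Or.inl ⟨rfl, rfl, rfl⟩)
  · exact isQuadruple_iff.mpr ⟨hxy, h2, hx0, hxu', hy0, hyu'⟩
  · exact Or.inl (Or.inr (Or.inl ⟨rfl, rfl, rfl⟩))

theorem reach_replace_left (hcentral : Subalgebra.center F A = ⊥)
    (hdim : Module.finrank F A = 16) {x' : A} (h : IsQuadruple F (x, y, z, u))
    {M : Submodule F A} (hM : ∀ m ∈ M, ∃ γ : F, m * m = γ • (1 : A))
    (hq : ContainsQuadruple M (x, y, z, u)) (hx' : QPair F x' y) (hxM : x' * y ∈ M) :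
    ∃ w v : A, Reach F 2 1 (x, y, z, u) (x', y, w, v) ∧ ContainsQuadruple M (x', y, w, v) := by
  have := charP_two_of_algebra F (A := A)
  obtain ⟨hxy, hzu, hxz, hxu, hyz, hyu⟩ := isQuadruple_iff.mp h
  obtain ⟨β, hβ⟩ := hxy.squareCentral
  have hβ0 := ne_zero_of_mul_self_eq_smul hxy.ne hβ
  obtain ⟨hqy, hqe, hqu, hqf⟩ := hq
  simp only at hqy hqe hqu hqf
  obtain ⟨c, a, b, d, e, hm⟩ := _root_.mem_traceZeroSpace.mp
    (ContainsQuadruple.mem_traceZeroSpace hcentral hdim h hM ⟨hqy, hqe, hqu, hqf⟩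
      (M.add_mem hxM hqe))
  have hg : QPair F z (d • u + e • (z * u)) ∨ d • u + e • (z * u) = 0 := by
    by_cases hg : d • u + e • (z * u) = 0
    · exact Or.inr hg
    · exact Or.inl (hzu.of_plane d e hg)
  have hgM : d • u + e • (z * u) ∈ M := M.add_mem (M.smul_mem _ hqu) (M.smul_mem _ hqf)
  have hzgM : z * (d • u + e • (z * u)) ∈ M := by
    obtain ⟨γ, hγ⟩ := hzu.artinSchreier
    have : z * (d • u + e • (z * u)) = d • (z * u) + e • (z * u + γ • u) := by
      rw [mul_add, mul_smul_comm, mul_smul_comm, ← mul_assoc, hγ, add_mul, smul_mul_assoc, one_mul]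
    rw [this]
    exact M.add_mem (M.smul_mem _ hqf) (M.smul_mem _ (M.add_mem hqf (M.smul_mem _ hqu)))
  have hxg : x * (d • u + e • (z * u)) = (d • u + e • (z * u)) * x := by
    rw [mul_add, add_mul, mul_smul_comm, mul_smul_comm, smul_mul_assoc, smul_mul_assoc, hxu,
      ← mul_assoc, hxz, mul_assoc, hxu, mul_assoc]
  have hyg : y * (d • u + e • (z * u)) = (d • u + e • (z * u)) * y := by
    rw [mul_add, add_mul, mul_smul_comm, mul_smul_comm, smul_mul_assoc, smul_mul_assoc, hyu,
      ← mul_assoc, hyz, mul_assoc, hyu, mul_assoc]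
  generalize d • u + e • (z * u) = g at *
  have hb : b = 0 := by
    have h1 : (x' * y + x * y) * y + y * (x' * y + x * y) = 0 := by
      rw [mul_add, ← mul_assoc y, ← mul_assoc y, hx'.rel, hxy.rel]
      grind
    have h2 : (b * β) • (1 : A) = 0 := by
      rw [mul_smul, ← hxy.polar hβ, ← h1, hm]
      simp only [add_mul, mul_add, smul_mul_assoc, mul_smul_comm, smul_add, one_mul, mul_one, hyg]
      grind
    simpa [hβ0] using h2
  subst hb
  have hx'e : x' = x + β⁻¹ • (y * g) + a • (1 : A) + (β⁻¹ * c) • y := by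
    have h1 : β • (x' + x) = c • y + a • (β • (1 : A)) + y * g := by
      have h2 := congrArg (· * y) hm
      simp only [add_mul, mul_assoc, hβ, smul_mul_assoc, mul_smul_comm, mul_one, one_mul,
        zero_smul, add_zero, ← hyg] at h2
      rw [smul_add, h2]
    have h3 : x' + x = β⁻¹ • (y * g) + a • (1 : A) + (β⁻¹ * c) • y := by
      rw [← inv_smul_smul₀ hβ0 (x' + x), h1]
      match_scalars <;> field_simp
    linear_combination (norm := skip) h3
    grind
  rcases hg with hg | rfl
  · have h1 : IsQuadruple F (x, y, z, g) := isQuadruple_iff.mpr ⟨hxy, hg, hxz, hxg, hyz, hyg⟩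
    have h2 := h1.omegaI β⁻¹
    obtain ⟨h3, h4, h5, h6, h7, h8⟩ := isQuadruple_iff.mp h2
    have hcomm : ∀ w, (x + β⁻¹ • (y * g)) * w = w * (x + β⁻¹ • (y * g)) → y * w = w * y →
        x' * w = w * x' := by
      intro w hw hyw
      generalize x + β⁻¹ • (y * g) = v at hx'e hw
      rw [hx'e]
      simp [add_mul, mul_add, hw, hyw]
    have h9 : IsQuadruple F (x', y, z + β⁻¹ • (y * g), g) :=
      isQuadruple_iff.mpr ⟨hx', h4, hcomm _ h5 h7, hcomm _ h6 h8, h7, h8⟩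
    refine ⟨_, g, (((Reach.refl h).lambda (s := (x, y, z, g)) ?_ h1).omega ?_ h2).lambda ?_ h9,
      hqy, hxM, hgM, ?_⟩
    · exact Or.inl (Or.inl ⟨rfl, rfl, rfl⟩)
    · exact Or.inl (Or.inl ⟨rfl, rfl, β⁻¹, rfl, rfl⟩)
    · exact Or.inl (Or.inr (Or.inr (Or.inr ⟨rfl, rfl, rfl⟩)))
    · obtain ⟨δ, hδ⟩ := hg.squareCentral
      have : (z + β⁻¹ • (y * g)) * g = z * g + β⁻¹ • δ • y := by
        rw [add_mul, smul_mul_assoc, mul_assoc, hδ, mul_smul_comm, mul_one]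
      simp only [this]
      exact M.add_mem hzgM (M.smul_mem _ (M.smul_mem _ hqy))
  · have hx'e' : x' = x + a • (1 : A) + (β⁻¹ * c) • y := by simpa using hx'e
    refine ⟨z, u, ((Reach.single_lambda h ?_ ?_).pad_lambda one_le_two).pad_omega zero_le_one,
      hqy, hxM, hqu, hqf⟩
    · exact Or.inl (Or.inr (Or.inr (Or.inr ⟨rfl, rfl, rfl⟩)))
    · refine isQuadruple_iff.mpr ⟨hx', hzu, ?_, ?_, hyz, hyu⟩
      · simp [hx'e', add_mul, mul_add, hxz, hyz]
      · simp [hx'e', add_mul, mul_add, hxu, hyu]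

theorem reach_replace_right_of_polar_ne_zero (hcentral : Subalgebra.center F A = ⊥)
    (hdim : Module.finrank F A = 16) {v : A} (h : IsQuadruple F (x, y, z, u))
    {M : Submodule F A} (hM : ∀ m ∈ M, ∃ γ : F, m * m = γ • (1 : A))
    (hq : ContainsQuadruple M (x, y, z, u)) (hv : v ∈ M) (hne : y * v + v * y ≠ 0) :
    ∃ r s w : A, Reach F 3 1 (x, y, z, u) (r, v, s, w) ∧ ContainsQuadruple M (r, v, s, w) := by
  have := charP_two_of_algebra F (A := A)
  obtain ⟨c, hc⟩ := exists_polar hM hq.1 hv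
  simp only at hc
  have hc0 : c ≠ 0 := by rintro rfl; exact hne (by rw [hc, zero_smul])
  obtain ⟨h1, h2⟩ := QPair.of_anticomm (hM y hq.1) (hM v hv) hc0 hc
  obtain ⟨β, hβ⟩ := h1.squareCentral
  obtain ⟨δ, hδ⟩ := h2.squareCentral
  have hβ0 := ne_zero_of_mul_self_eq_smul h1.ne hβ
  have hry : c⁻¹ • (y * v) * y ∈ M := by
    have h3 : v * y = y * v + c • (1 : A) := by rw [← hc]; grind
    have : c⁻¹ • (y * v) * y = c⁻¹ • (β • v + c • y) := by
      rw [smul_mul_assoc, mul_assoc, h3, mul_add, ← mul_assoc, hβ, smul_mul_assoc, one_mul,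
        mul_smul_comm, mul_one]
    rw [this]
    exact M.smul_mem _ (M.add_mem (M.smul_mem _ hv) (M.smul_mem _ hq.1))
  have hrv : c⁻¹ • (y * v) * v ∈ M := by
    rw [smul_mul_assoc, mul_assoc, hδ, mul_smul_comm, mul_one]
    exact M.smul_mem _ (M.smul_mem _ hq.1)
  obtain ⟨s, w, hR, hC⟩ := reach_replace_left hcentral hdim h hM hq h1 hry
  obtain ⟨-, hsw, hrs, hrw, hys, hyw⟩ := isQuadruple_iff.mp hR.right_isQuadruple
  have hcomm : ∀ t : A, c⁻¹ • (y * v) * t = t * c⁻¹ • (y * v) → y * t = t * y →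
      v * t = t * v := by
    intro t ht hyt
    have h3 : y * v * t = t * (y * v) := by
      have := congrArg (c • ·) ht
      simpa [smul_smul, hc0] using this
    refine mul_left_cancel₀ h1.ne ?_
    rw [← mul_assoc, h3, ← mul_assoc, ← hyt, mul_assoc]
  refine ⟨_, s, w, hR.lambda (s := (c⁻¹ • (y * v), v, s, w)) ?_ ?_, hv, hrv, hC.2.2.1, hC.2.2.2⟩
  · exact Or.inl (Or.inr (Or.inr (Or.inl ⟨rfl, rfl, rfl⟩)))
  · exact isQuadruple_iff.mpr ⟨h2, hsw, hrs, hrw, hcomm s hrs hys, hcomm w hrw hyw⟩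

theorem reach_replace_right_of_polar_pair (hcentral : Subalgebra.center F A = ⊥)
    (hdim : Module.finrank F A = 16) {v : A} (h : IsQuadruple F (x, y, z, u))
    {M : Submodule F A} (hM : ∀ m ∈ M, ∃ γ : F, m * m = γ • (1 : A))
    (hq : ContainsQuadruple M (x, y, z, u)) (hv : v ∈ M)
    (hne : y * v + v * y ≠ 0 ∨ x * y * v + v * (x * y) ≠ 0) :
    ∃ r s w : A, Reach F 4 1 (x, y, z, u) (r, v, s, w) ∧ ContainsQuadruple M (r, v, s, w) := by
  rcases hne with hne | hne
  · obtain ⟨r, s, w, hR, hC⟩ :=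
      reach_replace_right_of_polar_ne_zero hcentral hdim h hM hq hv hne
    exact ⟨r, s, w, hR.pad_lambda (by norm_num), hC⟩
  · obtain ⟨hxy, hzu, hxz, hxu, hyz, hyu⟩ := isQuadruple_iff.mp h
    obtain ⟨α, hα⟩ := hxy.artinSchreier
    have h1 : IsQuadruple F (x, x * y, z, u) := by
      refine isQuadruple_iff.mpr ⟨?_, hzu, hxz, hxu, ?_, ?_⟩
      · have h0 : x * y ≠ 0 := fun h0 => hne (by rw [h0, zero_mul, mul_zero, add_zero])
        simpa using hxy.of_plane 0 1 (by simpa using h0)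
      · rw [mul_assoc, hyz, ← mul_assoc, hxz, mul_assoc]
      · rw [mul_assoc, hyu, ← mul_assoc, hxu, mul_assoc]
    have h2 : ContainsQuadruple M (x, x * y, z, u) := by
      refine ⟨hq.2.1, ?_, hq.2.2.1, hq.2.2.2⟩
      simp only
      rw [← mul_assoc, hα, add_mul, smul_mul_assoc, one_mul]
      exact M.add_mem hq.2.1 (M.smul_mem _ hq.1)
    obtain ⟨r, s, w, hR, hC⟩ :=
      reach_replace_right_of_polar_ne_zero hcentral hdim h1 hM h2 hv hne
    refine ⟨r, s, w, ?_, hC⟩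
    have h3 : Reach F 1 0 (x, y, z, u) (x, x * y, z, u) :=
      Reach.single_lambda h (Or.inl (Or.inr (Or.inr (Or.inl ⟨rfl, rfl, rfl⟩)))) h1
    simpa [Nat.add_comm] using h3.trans hR

theorem reach_replace_right (hcentral : Subalgebra.center F A = ⊥)
    (hdim : Module.finrank F A = 16) {v : A} (h : IsQuadruple F (x, y, z, u))
    {M : Submodule F A} (hM : ∀ m ∈ M, ∃ γ : F, m * m = γ • (1 : A))
    (hq : ContainsQuadruple M (x, y, z, u)) (hv : v ∈ M) (hne : ∀ c : F, v ≠ c • (1 : A)) :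
    ∃ r s w : A, Reach F 5 1 (x, y, z, u) (r, v, s, w) ∧ ContainsQuadruple M (r, v, s, w) := by
  have := charP_two_of_algebra F (A := A)
  by_cases h1 : y * v + v * y ≠ 0 ∨ x * y * v + v * (x * y) ≠ 0
  · obtain ⟨r, s, w, hR, hC⟩ := reach_replace_right_of_polar_pair hcentral hdim h hM hq hv h1
    exact ⟨r, s, w, hR.pad_lambda (by norm_num), hC⟩
  by_cases h2 : u * v + v * u ≠ 0 ∨ z * u * v + v * (z * u) ≠ 0
  · obtain ⟨r, s, w, hR, hC⟩ :=
      reach_replace_right_of_polar_pair hcentral hdim h.quadSwap hM hq.swap hv h2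
    refine ⟨r, s, w, ?_, hC⟩
    have h3 : Reach F 1 0 (x, y, z, u) (z, u, x, y) :=
      Reach.single_lambda h (Or.inr (Or.inl ⟨rfl, rfl, rfl⟩)) h.quadSwap
    simpa [Nat.add_comm] using h3.trans hR
  · push Not at h1 h2
    obtain ⟨c, hc⟩ := exists_eq_smul_one_of_commute_traceZero hcentral hdim h
      (CharTwo.add_eq_zero.mp h1.1).symm (CharTwo.add_eq_zero.mp h1.2).symm
      (CharTwo.add_eq_zero.mp h2.1).symm (CharTwo.add_eq_zero.mp h2.2).symm
    exact absurd hc (hne c)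

/-- Quadruples contained in a common space of square-central elements are connected. -/
theorem reach_of_containsQuadruple (hcentral : Subalgebra.center F A = ⊥)
    (hdim : Module.finrank F A = 16) {x' y' z' u' : A} (h : IsQuadruple F (x, y, z, u))
    (h' : IsQuadruple F (x', y', z', u')) {M : Submodule F A}
    (hM : ∀ m ∈ M, ∃ γ : F, m * m = γ • (1 : A)) (hq : ContainsQuadruple M (x, y, z, u))
    (hq' : ContainsQuadruple M (x', y', z', u')) :
    Reach F 11 2 (x, y, z, u) (x', y', z', u') := by
  obtain ⟨hxy', -⟩ := isQuadruple_iff.mp h'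
  have hne : ∀ c : F, y' ≠ c • (1 : A) := by
    intro c hc
    have h3 := hxy'.rel
    rw [hc] at h3
    exact hxy'.ne (by rw [hc]; simpa using h3)
  obtain ⟨r, s, w, hR, hC⟩ := reach_replace_right hcentral hdim h hM hq hq'.1 hne
  obtain ⟨s', w', hR', hC'⟩ :=
    reach_replace_left hcentral hdim hR.right_isQuadruple hM hC hxy' hq'.2.1
  exact (hR.trans hR').trans
    (reach_of_share_pair hcentral hdim hR'.right_isQuadruple h' hM hC' hq'.2.2.1)

end Connectivity

section Main

variable {F A : Type*} [Field F] [CharP F 2] [DivisionRing A] [Algebra F A] {x y z u : A}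

theorem IsQuadruple.omegaS (h : IsQuadruple F (x, y, z, u)) (hne : x + z ≠ 0) {t : F}
    (ht : t ≠ 0) :
    IsQuadruple F (x, (t • (x + z)) * y, z, (t • (x + z)) * u) := by
  have := charP_two_of_algebra F (A := A)
  obtain ⟨⟨hy, ⟨α, hα⟩, ⟨β, hβ⟩, hr⟩, ⟨hu, ⟨γ, hγ⟩, ⟨δ, hδ⟩, hr'⟩, hxz, hxu, hyz, hyu⟩ :=
    isQuadruple_iff.mp h
  have hs : (x + z) * (x + z) = x + z + (α + γ) • (1 : A) := by
    simp only [add_mul, mul_add, hα, hγ, hxz, add_smul]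
    grind
  have hsx : x * (x + z) = (x + z) * x := by rw [mul_add, add_mul, hxz]
  have hsz : z * (x + z) = (x + z) * z := by rw [mul_add, add_mul, hxz]
  have hsy : y * (x + z) = (x + z) * y + y := by
    rw [mul_add, add_mul, hr, hyz]
    abel
  have hsu : u * (x + z) = (x + z) * u + u := by
    rw [mul_add, add_mul, hr', hxu]
    abel
  generalize x + z = s at *
  have hs' : ∀ w, s * (s * w) = s * w + (α + γ) • w := fun w => by
    rw [← mul_assoc, hs, add_mul, smul_mul_assoc, one_mul]
  have hsy' : ∀ w, y * (s * w) = s * (y * w) + y * w := fun w => by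
    rw [← mul_assoc, hsy, add_mul, mul_assoc]
  have hsu' : ∀ w, u * (s * w) = s * (u * w) + u * w := fun w => by
    rw [← mul_assoc, hsu, add_mul, mul_assoc]
  have hsx' : ∀ w, x * (s * w) = s * (x * w) := fun w => by
    rw [← mul_assoc, hsx, mul_assoc]
  have hsz' : ∀ w, z * (s * w) = s * (z * w) := fun w => by
    rw [← mul_assoc, hsz, mul_assoc]
  refine isQuadruple_iff.mpr
    ⟨⟨mul_ne_zero (smul_ne_zero ht hne) hy, ⟨α, hα⟩, ⟨t ^ 2 * (α + γ) * β, ?_⟩, ?_⟩,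
      ⟨mul_ne_zero (smul_ne_zero ht hne) hu, ⟨γ, hγ⟩, ⟨t ^ 2 * (α + γ) * δ, ?_⟩, ?_⟩,
      hxz, ?_, ?_, ?_⟩
  · simp only [smul_mul_assoc, mul_smul_comm, mul_assoc, mul_add, hsy', hs, hs', hβ, smul_add,
      smul_smul, mul_one]
    clear hs' hsy' hsu' hsx' hsz'
    match_scalars <;> grind
  · simp only [smul_mul_assoc, mul_smul_comm, mul_assoc, hr, hsx', mul_add, smul_add]
  · simp only [smul_mul_assoc, mul_smul_comm, mul_assoc, mul_add, hsu', hs, hs', hδ, smul_add,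
      smul_smul, mul_one]
    clear hs' hsy' hsu' hsx' hsz'
    match_scalars <;> grind
  · simp only [smul_mul_assoc, mul_smul_comm, mul_assoc, hr', hsz', mul_add, smul_add]
  · simp only [smul_mul_assoc, mul_smul_comm, mul_assoc, hxu, hsx']
  · simp only [smul_mul_assoc, mul_smul_comm, mul_assoc, hyz, hsz']
  · simp only [smul_mul_assoc, mul_smul_comm, mul_assoc, hsu', hsy', hyu]

theorem one_add_inv_eq {v : A} {β : F} (hβ : v * v = β • (1 : A)) (hne : 1 + v ≠ 0) :
    ∃ k : F, k * (1 + β) = 1 ∧ (1 + v)⁻¹ = k • (1 + v) := by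
  have := charP_two_of_algebra F (A := A)
  have hsq : (1 + v) * (1 + v) = (1 + β) • (1 : A) := by
    rw [add_smul, one_smul, ← hβ]
    grind
  have hn : 1 + β ≠ 0 := ne_zero_of_mul_self_eq_smul hne hsq
  refine ⟨(1 + β)⁻¹, inv_mul_cancel₀ hn, ?_⟩
  refine inv_eq_of_mul_eq_one_right ?_
  rw [mul_smul_comm, hsq, smul_smul, inv_mul_cancel₀ hn, one_smul]

theorem IsQuadruple.omegaC (h : IsQuadruple F (x, y, z, u)) (hne : 1 + y ≠ 0) :
    IsQuadruple F (x + y * (1 + y)⁻¹ * z, y, z, (1 + y) * u) := by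
  have := charP_two_of_algebra F (A := A)
  obtain ⟨⟨hy, ⟨α, hα⟩, ⟨β, hβ⟩, hr⟩, ⟨hu, ⟨γ, hγ⟩, ⟨δ, hδ⟩, hr'⟩, hxz, hxu, hyz, hyu⟩ :=
    isQuadruple_iff.mp h
  obtain ⟨k, hk, hinv⟩ := one_add_inv_eq hβ hne
  have e1 : y * (1 + y)⁻¹ * z = k • (y * z + β • z) := by
    rw [hinv, mul_smul_comm, smul_mul_assoc, mul_add, add_mul, hβ, mul_one, smul_mul_assoc,
      one_mul]
  have hy' : ∀ w, y * (y * w) = β • w := fun w => by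
    rw [← mul_assoc, hβ, smul_mul_assoc, one_mul]
  have hr1 : ∀ w, y * (x * w) = x * (y * w) + y * w := fun w => by
    rw [← mul_assoc, hr, add_mul, mul_assoc]
  have hr2 : ∀ w, u * (z * w) = z * (u * w) + u * w := fun w => by
    rw [← mul_assoc, hr', add_mul, mul_assoc]
  have hxz' : ∀ w, z * (x * w) = x * (z * w) := fun w => by
    rw [← mul_assoc, ← hxz, mul_assoc]
  have hyz' : ∀ w, z * (y * w) = y * (z * w) := fun w => by
    rw [← mul_assoc, ← hyz, mul_assoc]
  have hxu' : ∀ w, u * (x * w) = x * (u * w) := fun w => by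
    rw [← mul_assoc, ← hxu, mul_assoc]
  have hyu' : ∀ w, u * (y * w) = y * (u * w) := fun w => by
    rw [← mul_assoc, ← hyu, mul_assoc]
  rw [e1]
  refine isQuadruple_iff.mpr
    ⟨⟨hy, ⟨α + k * β * γ, ?_⟩, ⟨β, hβ⟩, ?_⟩,
      ⟨mul_ne_zero hne hu, ⟨γ, hγ⟩, ⟨(1 + β) * δ, ?_⟩, ?_⟩, ?_, ?_, hyz, ?_⟩
  all_goals
    simp only [smul_mul_assoc, mul_smul_comm, mul_assoc, mul_add, add_mul, smul_add, smul_smul,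
      mul_one, one_mul, hα, hβ, hγ, hδ, hr, hr', ← hxz, ← hyz, ← hxu, ← hyu, hy', hr1, hr2, hxz',
      hyz', hxu', hyu']
  all_goals
    clear hy' hr1 hr2 hxz' hyz' hxu' hyu'
    match_scalars <;> grind

/-- A quadruple adapted to the same involution as `Q'` is connected to `Q'`. -/
theorem IsAdapted.reach (hcentral : Subalgebra.center F A = ⊥)
    (hdim : Module.finrank F A = 16) {x' y' z' u' : A} (h : IsQuadruple F (x, y, z, u))
    (h' : IsQuadruple F (x', y', z', u')) {T : A →ₗ[F] A} (hT : IsInvolution T)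
    (hTq : IsAdapted T (x, y, z, u)) (hTq' : IsAdapted T (x', y', z', u')) :
    Reach F 11 2 (x, y, z, u) (x', y', z', u') :=
  reach_of_containsQuadruple hcentral hdim h h' (fun _ => h'.mul_self_of_mem_traceZeroSpace)
    (hTq.containsQuadruple hdim h h' hT hTq') (containsQuadruple_traceZeroSpace _)

/-- Two elementary steps add an arbitrary element of the plane of `y` and `x * y`, up to scalars,
to `x`. -/
theorem QPair.exists_add_plane (h : QPair F x y) {T : A →ₗ[F] A} (hT : IsInvolution T)
    (hx : T x = x + 1) (hy : T y = y) (c a b : F) :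
    ∃ v, QPair F x v ∧ QPair F (x + (c • (1 : A) + (a • y + b • (x * y)))) v ∧
      T v = v ∧ (∀ w, w * x = x * w → w * y = y * w → w * v = v * w) ∧
      T (x + (c • (1 : A) + (a • y + b • (x * y)))) =
        x + (c • (1 : A) + (a • y + b • (x * y))) + 1 := by
  have := charP_two_of_algebra F (A := A)
  have hxy : T (x * y) = x * y := by
    rw [hT.map_mul, hx, hy, mul_add, h.rel, mul_one]
    grind
  have hTp : T (a • y + b • (x * y)) = a • y + b • (x * y) := by
    rw [map_add, map_smul, map_smul, hy, hxy]
  have hTx : T (x + (c • (1 : A) + (a • y + b • (x * y)))) =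
        x + (c • (1 : A) + (a • y + b • (x * y))) + 1 := by
    rw [map_add, map_add, hTp, map_smul, hT.map_one, hx]
    abel
  by_cases h0 : a • y + b • (x * y) = 0
  · refine ⟨y, h, ?_, hy, fun w _ hw => hw, hTx⟩
    simpa [h0] using h.add_left c 0
  · refine ⟨_, h.of_plane a b h0, ?_, hTp, fun w hwx hwy => ?_, hTx⟩
    · simpa [add_assoc] using (h.of_plane a b h0).add_left c 1
    · exact ((Commute.smul_right (M := F) (show Commute w y from hwy) a).add_right
        ((Commute.mul_right hwx hwy).smul_right b)).eq

theorem reach_of_intertwiner_eq_add (hcentral : Subalgebra.center F A = ⊥)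
    (hdim : Module.finrank F A = 16) {x' y' z' u' : A} (h : IsQuadruple F (x, y, z, u))
    (h' : IsQuadruple F (x', y', z', u')) {T T' : A →ₗ[F] A} (hT : IsInvolution T)
    (hT' : IsInvolution T') (hTq : IsAdapted T (x, y, z, u))
    (hTq' : IsAdapted T' (x', y', z', u')) {t : F} (ht : t ≠ 0) {m : A}
    (hm : m ∈ traceZeroSpace F (x, y, z, u)) (hne : t • (x + z) + m ≠ 0)
    (ha : ∀ w, (t • (x + z) + m) * T w = T' w * (t • (x + z) + m)) :
    Reach F 15 3 (x, y, z, u) (x', y', z', u') := by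
  have := charP_two_of_algebra F (A := A)
  obtain ⟨hxy, hzu, hxz, hxu, hyz, hyu⟩ := isQuadruple_iff.mp h
  obtain ⟨hTx, hTy, hTz, hTu⟩ := hTq
  simp only at hTx hTy hTz hTu
  obtain ⟨c, a, b, d, e, hm'⟩ :=
    mem_traceZeroSpace.mp ((traceZeroSpace F (x, y, z, u)).smul_mem t⁻¹ hm)
  obtain ⟨v, hv1, hv2, hTv, hcv, hTx₁⟩ := hxy.exists_add_plane hT hTx hTy c a b
  obtain ⟨w, hw1, hw2, hTw, hcw, hTz₁⟩ := hzu.exists_add_plane hT hTz hTu 0 d e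
  have hcomm : ∀ s, x * s = s * x → y * s = s * y →
      (x + (c • (1 : A) + (a • y + b • (x * y)))) * s =
        s * (x + (c • (1 : A) + (a • y + b • (x * y)))) := by
    intro s hxs hys
    exact (Commute.add_left hxs (((Commute.one_left s).smul_left c).add_left
      ((Commute.smul_left (M := F) (show Commute y s from hys) a).add_left
        ((Commute.mul_left hxs hys).smul_left b)))).eq
  have hcomm' : ∀ s, z * s = s * z → u * s = s * u →
      (z + ((0 : F) • (1 : A) + (d • u + e • (z * u)))) * s =
        s * (z + ((0 : F) • (1 : A) + (d • u + e • (z * u)))) := by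
    intro s hzs hus
    exact (Commute.add_left hzs (((Commute.one_left s).smul_left 0).add_left
      ((Commute.smul_left (M := F) (show Commute u s from hus) d).add_left
        ((Commute.mul_left hzs hus).smul_left e)))).eq
  have ha' : t • (x + z) + m = t • (x + (c • (1 : A) + (a • y + b • (x * y))) +
      (z + ((0 : F) • (1 : A) + (d • u + e • (z * u))))) := by
    have : m = t • (c • (1 : A) + (a • y + b • (x * y)) + (d • u + e • (z * u))) := by
      rw [← hm', smul_inv_smul₀ ht]
    rw [this]
    module
  rw [ha'] at ha hne
  generalize x + (c • (1 : A) + (a • y + b • (x * y))) = x₁ at *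
  generalize z + ((0 : F) • (1 : A) + (d • u + e • (z * u))) = z₁ at *
  have hvz : v * z = z * v := (hcv z hxz.symm hyz.symm).symm
  have hvu : v * u = u * v := (hcv u hxu.symm hyu.symm).symm
  have hx₁z := hcomm z hxz hyz
  have hx₁u := hcomm u hxu hyu
  have hx₁w := hcw x₁ hx₁z hx₁u
  have hvw := hcw v hvz hvu
  have hx₁z₁ := (hcomm' x₁ hx₁z.symm hx₁u.symm).symm
  have hvz₁ := (hcomm' v hvz.symm hvu.symm).symm
  have h1 : IsQuadruple F (x, v, z, u) := isQuadruple_iff.mpr ⟨hv1, hzu, hxz, hxu, hvz, hvu⟩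
  have h2 : IsQuadruple F (x₁, v, z, u) :=
    isQuadruple_iff.mpr ⟨hv2, hzu, hx₁z, hx₁u, hvz, hvu⟩
  have h3 : IsQuadruple F (x₁, v, z, w) :=
    isQuadruple_iff.mpr ⟨hv2, hw1, hx₁z, hx₁w, hvz, hvw⟩
  have h4 : IsQuadruple F (x₁, v, z₁, w) :=
    isQuadruple_iff.mpr ⟨hv2, hw2, hx₁z₁, hx₁w, hvz₁, hvw⟩
  have hne' : x₁ + z₁ ≠ 0 := by
    intro h0
    exact hne (by rw [h0, smul_zero])
  have h5 := h4.omegaS hne' ht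
  have hR : Reach F 4 1 (x, y, z, u)
      (x₁, (t • (x₁ + z₁)) * v, z₁, (t • (x₁ + z₁)) * w) := by
    refine (((((Reach.refl h).lambda (s := (x, v, z, u)) ?_ h1).lambda
      (s := (x₁, v, z, u)) ?_ h2).lambda (s := (x₁, v, z, w)) ?_ h3).lambda
      (s := (x₁, v, z₁, w)) ?_ h4).omega ?_ h5
    · exact Or.inl (Or.inr (Or.inr (Or.inl ⟨rfl, rfl, rfl⟩)))
    · exact Or.inl (Or.inr (Or.inr (Or.inr ⟨rfl, rfl, rfl⟩)))
    · exact Or.inl (Or.inl ⟨rfl, rfl, rfl⟩)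
    · exact Or.inl (Or.inr (Or.inl ⟨rfl, rfl, rfl⟩))
    · exact Or.inr (Or.inl (Or.inl ⟨rfl, rfl, 0, t, by simp, by simp⟩))
  have hTs : T (t • (x₁ + z₁)) = t • (x₁ + z₁) := by
    rw [map_smul, map_add, hTx₁, hTz₁]
    congr 1
    grind
  have hsx : t • (x₁ + z₁) * x₁ = x₁ * t • (x₁ + z₁) := by
    rw [smul_mul_assoc, mul_smul_comm, add_mul, mul_add, hx₁z₁]
  have hsz : t • (x₁ + z₁) * z₁ = z₁ * t • (x₁ + z₁) := by
    rw [smul_mul_assoc, mul_smul_comm, add_mul, mul_add, hx₁z₁]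
  generalize t • (x₁ + z₁) = s at *
  refine (hR.trans (IsAdapted.reach hcentral hdim h5 h' hT' ?_ hTq'))
  have key : ∀ p q : A, s * T p = q * s → T' p = q := by
    intro p q hpq
    rw [ha] at hpq
    exact mul_right_cancel₀ hne hpq
  refine ⟨key _ _ ?_, key _ _ ?_, key _ _ ?_, key _ _ ?_⟩ <;> simp only
  · rw [hTx₁, mul_add, add_mul, hsx, mul_one, one_mul]
  · rw [hT.map_mul, hTs, hTv, mul_assoc]
  · rw [hTz₁, mul_add, add_mul, hsz, mul_one, one_mul]
  · rw [hT.map_mul, hTs, hTw, mul_assoc]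

theorem reach_of_intertwiner_eq_one_add (hcentral : Subalgebra.center F A = ⊥)
    (hdim : Module.finrank F A = 16) {x' y' z' u' : A} (h : IsQuadruple F (x, y, z, u))
    (h' : IsQuadruple F (x', y', z', u')) {T T' : A →ₗ[F] A} (hT : IsInvolution T)
    (hT' : IsInvolution T') (hTq : IsAdapted T (x, y, z, u))
    (hTq' : IsAdapted T' (x', y', z', u')) {v : A}
    (hv : v ∈ traceZeroSpace F (x, y, z, u)) (hvne : ∀ c : F, v ≠ c • (1 : A)) (hne : 1 + v ≠ 0)
    (ha : ∀ w, (1 + v) * T w = T' w * (1 + v)) :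
    Reach F 16 4 (x, y, z, u) (x', y', z', u') := by
  have := charP_two_of_algebra F (A := A)
  obtain ⟨r, s, w, hR, hC⟩ := reach_replace_right hcentral hdim h
    (fun _ => h.mul_self_of_mem_traceZeroSpace) (containsQuadruple_traceZeroSpace _) hv hvne
  have h1 := hR.right_isQuadruple
  obtain ⟨hrv, hsw, hrs, hrw, hvs, hvw⟩ := isQuadruple_iff.mp h1
  obtain ⟨hTr, hTv, hTs, hTw⟩ := hC.isAdapted hT h1
    (fun m hm => hT.map_of_mem_traceZeroSpace h hTq hm)
  simp only at hTr hTv hTs hTw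
  have h2 := h1.omegaC hne
  have hR2 : Reach F 5 2 (x, y, z, u) (r + v * (1 + v)⁻¹ * s, v, s, (1 + v) * w) := by
    refine hR.omega (Or.inr (Or.inr (Or.inl ⟨rfl, rfl, 1, ?_, ?_, ?_⟩))) h2
    · rw [one_smul]
      exact isUnit_iff_ne_zero.mpr hne
    · rw [one_smul]
    · rw [one_smul]
  refine hR2.trans (IsAdapted.reach hcentral hdim h2 h' hT' ?_ hTq')
  have key : ∀ p q : A, (1 + v) * T p = q * (1 + v) → T' p = q := by
    intro p q hpq
    rw [ha] at hpq
    exact mul_right_cancel₀ hne hpq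
  obtain ⟨β, hβ⟩ := hrv.squareCentral
  obtain ⟨k, hk, hinv⟩ := one_add_inv_eq hβ hne
  have hTp : T (v * (1 + v)⁻¹) = v * (1 + v)⁻¹ := by
    rw [hinv]
    simp only [hT.map_mul, map_smul, map_add, hTv, mul_add, mul_smul_comm, mul_one]
  have hpa : (1 + v) * (v * (1 + v)⁻¹) = v := by
    have : (1 + v) * v = v * (1 + v) := by rw [add_mul, mul_add, one_mul, mul_one]
    rw [← mul_assoc, this, mul_assoc, mul_inv_cancel₀ hne, mul_one]
  have hpa' : v * (1 + v)⁻¹ * (1 + v) = v := by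
    rw [mul_assoc, inv_mul_cancel₀ hne, mul_one]
  have hsp : s * (v * (1 + v)⁻¹) = v * (1 + v)⁻¹ * s := by
    rw [hinv]
    simp only [mul_add, add_mul, mul_smul_comm, smul_mul_assoc, mul_one, ← hvs, ← mul_assoc]
    simp only [mul_assoc, ← hvs]
  have hr := hrv.rel
  refine ⟨key _ _ ?_, key _ _ ?_, key _ _ ?_, key _ _ ?_⟩ <;> simp only
  · generalize v * (1 + v)⁻¹ = p at *
    rw [map_add, hT.map_mul, hTp, hTs, hTr]
    have e1 : (1 + v) * (p * s) = v * s := by rw [← mul_assoc, hpa]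
    have e2 : p * s * (1 + v) = s * v := by rw [← hsp, mul_assoc, hpa']
    have e3 : (1 + v) * ((s + 1) * p) = v * s + v := by
      have : (s + 1) * p = p * s + p := by rw [add_mul, one_mul, hsp]
      rw [this, mul_add, e1, hpa]
    have e4 : (r + p * s + 1) * (1 + v) = r * (1 + v) + s * v + (1 + v) := by
      rw [add_mul, add_mul, one_mul, e2]
    rw [mul_add, e3, e4]
    have e5 : v * r = r * v + v := by
      clear key e1 e2 e3 e4 hpa hpa' hsp hTp hinv
      grind
    have e6 : (1 + v) * (r + 1) + (v * s + v) = r * (1 + v) + v * s + (1 + v) + (v + v) := by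
      simp only [mul_add, add_mul, mul_one, one_mul, e5]
      abel
    rw [← hvs, e6, CharTwo.add_self_eq_zero, add_zero]
  · rw [hTv, mul_add, add_mul, one_mul, mul_one]
  · rw [hTs]
    simp only [mul_add, add_mul, mul_one, one_mul, hvs]
    abel
  · rw [hT.map_mul, map_add, hT.map_one, hTv, hTw, mul_assoc]

theorem reach_of_isQuadruple (hcentral : Subalgebra.center F A = ⊥)
    (hdim : Module.finrank F A = 16) {x' y' z' u' : A} (h : IsQuadruple F (x, y, z, u))
    (h' : IsQuadruple F (x', y', z', u')) : Reach F 16 4 (x, y, z, u) (x', y', z', u') := by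
  have := charP_two_of_algebra F (A := A)
  obtain ⟨T, hT, hTq⟩ := exists_involution hdim h
  obtain ⟨T', hT', hTq'⟩ := exists_involution hdim h'
  obtain ⟨a, ha0, ha⟩ := exists_intertwiner hdim h hT hTq hT'
  have hTa := hT.map_intertwiner hcentral hT' ha0 ha
  have haa := hT.exists_intertwiner_eq_add hTq'.1 ha hTa
  obtain ⟨t, m, hm, htm⟩ := hTq.exists_add_map_eq hdim h hT (x' * a)
  rw [← haa] at htm
  by_cases ht : t = 0
  · rw [ht, zero_smul, zero_add] at htm
    subst htm
    by_cases hc : ∃ c : F, a = c • (1 : A)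
    · obtain ⟨c, rfl⟩ := hc
      have hTT : T = T' := by
        ext w
        refine mul_left_cancel₀ ha0 ?_
        rw [ha, mul_smul_comm, smul_mul_assoc, mul_one, one_mul]
      subst hTT
      exact ((hTq.reach hcentral hdim h h' hT hTq').pad_lambda (by norm_num)).pad_omega
        (by norm_num)
    · push Not at hc
      have e : 1 + (a + 1) = a := by grind
      refine reach_of_intertwiner_eq_one_add hcentral hdim h h' hT hT' hTq hTq' (v := a + 1)
        (Submodule.add_mem _ hm (Submodule.subset_span (by simp))) (fun c hca => hc (c + 1) ?_)
        (by rwa [e]) (by rwa [e])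
      rw [add_smul, one_smul, ← hca]
      grind
  · rw [htm] at ha0 ha
    exact ((reach_of_intertwiner_eq_add hcentral hdim h h' hT hT' hTq hTq' ht hm ha0
      ha).pad_lambda (by norm_num)).pad_omega (by norm_num)

end Main

/-- Every two quadruples of generators of a biquaternion division algebra are connected by a
chain of at most `45` steps of type `Λ₁`, `Ω_i`, `Ω_s` or `Ω_c`, with at most `6` steps of
type `Ω_i`, `Ω_s` or `Ω_c`, all remaining steps being of type `Λ₁`. -/
theorem lambda1_omega_chain (F A : Type*) [Field F] [CharP F 2] [DivisionRing A] [Algebra F A]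
    (hcentral : Subalgebra.center F A = ⊥) (hdim : Module.finrank F A = 16)
    (hbiquat : ∃ q : A × A × A × A, IsQuadruple F q)
    (Q Q' : A × A × A × A) (hQ : IsQuadruple F Q) (hQ' : IsQuadruple F Q') :
    ∃ n ≤ 45, ∃ c : ℕ → A × A × A × A, ∃ t : ℕ → Bool,
      c 0 = Q ∧ c n = Q' ∧ (∀ i ≤ n, IsQuadruple F (c i)) ∧
      (∀ i < n, if t i then Lambda1Step (c i) (c (i + 1))
        else OmegaIStep F (c i) (c (i + 1)) ∨ OmegaSStep F (c i) (c (i + 1)) ∨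
          OmegaCStep F (c i) (c (i + 1))) ∧
      ((Finset.range n).filter fun i => t i = false).card ≤ 6 := by
  obtain ⟨x, y, z, u⟩ := Q
  obtain ⟨x', y', z', u'⟩ := Q'
  obtain ⟨c, t, h0, hn, hc, ht, hcard⟩ :=
    (reach_of_isQuadruple hcentral hdim hQ hQ').exists_chain
  exact ⟨16 + 4, by norm_num, c, t, h0, hn, hc, ht, by rw [hcard]; norm_num⟩
end

section
/- If x ∈ A is an Artin–Schreier element with x ∉ F·1 and u ∈ A is a square-central element with u ∉ F·1 such that xu = ux, then there exist an Artin–Schreier element z ∈ A and a square-central element y ∈ A such that (x, y, z, u) is a quadruple of generators of A. -/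
open scoped TensorProduct Quaternion

section CharTwo

variable {A : Type*} [DivisionRing A] [CharP A 2]

theorem eq_zero_and_eq_zero_of_add_mul_eq_zero {x y w p q : A} (hw : w ≠ 0)
    (hxy : x * y + y * x = w) (hp : p * x = x * p) (hq : q * x = x * q) (h : p + q * y = 0) :
    p = 0 ∧ q = 0 := by
  have h2 : (2 : A) = 0 := CharTwo.two_eq_zero
  have hqw : q * w = 0 := by
    linear_combination (norm := noncomm_ring) - q * hxy + x * h + h * x + hq * y - hp
      - h2 * (x * p)
  have hq0 : q = 0 := (mul_eq_zero.1 hqw).resolve_right hw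
  subst hq0
  simpa using h

theorem add_commutator_mul {x a t : A} (hx : x * x = x + a) (ha : a * t = t * a) :
    (t + (x * t + t * x)) * x = x * (t + (x * t + t * x)) := by
  have h2 : (2 : A) = 0 := CharTwo.two_eq_zero
  linear_combination (norm := noncomm_ring) t * hx - hx * t - ha + h2 * (t * x - x * t)

theorem mul_commutator_add {x a t : A} (hx : x * x = x + a) (ha : a * t = t * a) :
    x * (x * t + t * x) + (x * t + t * x) * x = x * t + t * x := by
  have h2 : (2 : A) = 0 := CharTwo.two_eq_zero
  linear_combination (norm := noncomm_ring) t * hx + hx * t - ha + h2 * (x * t * x + a * t)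

theorem inv_mul_eq_add_one_mul_inv {x d : A} (hd : d ≠ 0) (hxd : x * d + d * x = d) :
    d⁻¹ * x = (x + 1) * d⁻¹ := by
  have h2 : (2 : A) = 0 := CharTwo.two_eq_zero
  rw [inv_mul_eq_iff_eq_mul₀ hd, ← mul_assoc, eq_mul_inv_iff_mul_eq₀ hd]
  linear_combination (norm := noncomm_ring) hxd - h2 * (d * x)

/-- An element commuting with the centralizer of `x` and with some `d ≠ 0` such that
`x d + d x = d` is central. -/
theorem commute_all_of_commute {x a d s : A} (hx : x * x = x + a) (ha : ∀ t, a * t = t * a)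
    (hd : d ≠ 0) (hxd : x * d + d * x = d) (hs : ∀ c, c * x = x * c → s * c = c * s)
    (hsd : s * d = d * s) (t : A) : s * t = t * s := by
  have h2 : (2 : A) = 0 := CharTwo.two_eq_zero
  have h0 := hs _ (add_commutator_mul hx (ha t))
  set e := x * t + t * x with he
  have hxe : x * e + e * x = e := mul_commutator_add hx (ha t)
  have h1 : s * (e * d⁻¹) = (e * d⁻¹) * s := by
    apply hs
    rw [mul_assoc, inv_mul_eq_add_one_mul_inv hd hxd]
    linear_combination (norm := noncomm_ring) h2 * (e * x * d⁻¹) - hxe * d⁻¹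
  have h3 : s * e = e * s := by
    have : e = e * d⁻¹ * d := by rw [mul_assoc, inv_mul_cancel₀ hd, mul_one]
    rw [this, ← mul_assoc, h1, mul_assoc, hsd, ← mul_assoc]
  linear_combination (norm := noncomm_ring) h0 - h3

end CharTwo

section Dimension

variable {F A V : Type*} [Field F] [DivisionRing A] [Algebra F A]
  [AddCommGroup V] [Module F V]

/-- The map `(p, q) ↦ f p + f q * w`. -/
noncomputable def LinearMap.addMulRight (f : V →ₗ[F] A) (w : A) : V × V →ₗ[F] A :=
  f.coprod ((LinearMap.mulRight F w).comp f)

theorem LinearMap.addMulRight_apply (f : V →ₗ[F] A) (w : A) (v : V × V) :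
    f.addMulRight w v = f v.1 + f v.2 * w := rfl

theorem LinearMap.addMulRight_injective [CharP A 2] {f : V →ₗ[F] A} (hf : Function.Injective f)
    {x y w : A}
    (hw : w ≠ 0) (hxy : x * y + y * x = w) (hfx : ∀ v, f v * x = x * f v) :
    Function.Injective (f.addMulRight y) := by
  rw [injective_iff_map_eq_zero] at hf ⊢
  intro v hv
  have := eq_zero_and_eq_zero_of_add_mul_eq_zero hw hxy (hfx v.1) (hfx v.2) hv
  exact Prod.ext (hf _ this.1) (hf _ this.2)

theorem LinearMap.addMulRight_mul_comm {f : V →ₗ[F] A} {x y : A} (hfx : ∀ v, f v * x = x * f v)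
    (hxy : y * x = x * y) (v : V × V) : f.addMulRight y v * x = x * f.addMulRight y v := by
  rw [addMulRight_apply, add_mul, mul_assoc, hxy, ← mul_assoc, hfx, hfx, mul_add, mul_assoc]

theorem LinearMap.addMulRight_mem {f : V →ₗ[F] A} {S : Subalgebra F A} (hf : ∀ v, f v ∈ S)
    {y : A} (hy : y ∈ S) (v : V × V) : f.addMulRight y v ∈ S :=
  add_mem (hf _) (mul_mem (hf _) hy)

end Dimension

section Involution

variable {F A : Type*} [Field F] [DivisionRing A] [Algebra F A]

/-- The quaternion basis attached to elements `x`, `y` with `x² + x = a`, `y² = b` and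
`xy + yx = y`. -/
def QuaternionAlgebra.Basis.ofCharTwo [CharP A 2] {x y : A} {a b : F}
    (hx : x ^ 2 + x = algebraMap F A a) (hy : y ^ 2 = algebraMap F A b)
    (hxy : x * y + y * x = y) : QuaternionAlgebra.Basis A a 1 b where
  i := x
  j := y
  k := x * y
  i_mul_i := by
    have h2 : (2 : A) = 0 := CharTwo.two_eq_zero
    rw [← Algebra.algebraMap_eq_smul_one, ← hx, one_smul]
    linear_combination (norm := noncomm_ring) - h2 * x
  j_mul_j := by rw [← Algebra.algebraMap_eq_smul_one, ← hy, sq]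
  i_mul_j := rfl
  j_mul_i := by rw [one_smul, eq_sub_iff_add_eq', hxy]

theorem commute_liftHom [CharP A 2] {a b c d : F} (p : QuaternionAlgebra.Basis A a 1 b)
    (q : QuaternionAlgebra.Basis A c 1 d) (hii : Commute p.i q.i) (hij : Commute p.i q.j)
    (hji : Commute p.j q.i) (hjj : Commute p.j q.j) (s : ℍ[F,a,1,b]) (t : ℍ[F,c,1,d]) :
    Commute (p.liftHom s) (q.liftHom t) := by
  have hs : p.liftHom s ∈ Algebra.adjoin F {p.i, p.j, p.k} := by
    rw [← p.range_liftHom]; exact ⟨s, rfl⟩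
  have ht : q.liftHom t ∈ Algebra.adjoin F {q.i, q.j, q.k} := by
    rw [← q.range_liftHom]; exact ⟨t, rfl⟩
  refine Algebra.commute_of_mem_adjoin_of_forall_mem_commute ht fun t' ht' => ?_
  refine (Algebra.commute_of_mem_adjoin_of_forall_mem_commute hs fun s' hs' => Commute.symm ?_).symm
  have hp {r : A} (hi : Commute p.i r) (hj : Commute p.j r) : Commute p.k r := by
    rw [← p.i_mul_j]; exact hi.mul_left hj
  have hq {r : A} (hi : Commute r q.i) (hj : Commute r q.j) : Commute r q.k := by
    rw [← q.i_mul_j]; exact hi.mul_right hj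
  rcases ht' with rfl | rfl | rfl <;> rcases hs' with rfl | rfl | rfl
  exacts [hii, hji, hp hii hji, hij, hjj, hp hij hjj, hq hii hij, hq hji hjj,
    hp (hq hii hij) (hq hji hjj)]

theorem exists_involution_s5 [CharP F 2] (hdim : Module.finrank F A = 16)
    (hbiquat : ∃ q : A × A × A × A, IsQuadruple F q) :
    ∃ τ : A →ₗ[F] A, (∀ a b, τ (a * b) = τ b * τ a) ∧ ∀ a, τ (τ a) = a := by
  obtain ⟨⟨x, y, z, u⟩, hy0, hu0, ⟨a, ha⟩, ⟨b, hb⟩, ⟨c, hc⟩, ⟨d, hd⟩, hxy, hxz, hxu, hyz, hyu,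
    hzu⟩ := hbiquat
  have : CharP A 2 := charP_of_injective_algebraMap (algebraMap F A).injective 2
  have : FiniteDimensional F A := .of_finrank_pos (by omega)
  let p := QuaternionAlgebra.Basis.ofCharTwo ha.symm hb.symm hxy
  let q := QuaternionAlgebra.Basis.ofCharTwo hc.symm hd.symm hzu
  let φ : ℍ[F,a,1,b] ⊗[F] ℍ[F,c,1,d] →ₐ[F] A :=
    Algebra.TensorProduct.lift p.liftHom q.liftHom (commute_liftHom p q hxz hxu hyz hyu)
  have hφl (s) : p.liftHom s ∈ φ.range :=
    ⟨s ⊗ₜ 1, by simp [φ, QuaternionAlgebra.Basis.lift_one]⟩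
  have hφr (s) : q.liftHom s ∈ φ.range :=
    ⟨1 ⊗ₜ s, by simp [φ, QuaternionAlgebra.Basis.lift_one]⟩
  have hxφ : x ∈ φ.range := by
    have := hφl (QuaternionAlgebra.Basis.self F).i
    rwa [QuaternionAlgebra.Basis.liftHom_apply, show p.lift _ = x by
      simp [QuaternionAlgebra.Basis.lift, p, QuaternionAlgebra.Basis.ofCharTwo]] at this
  have hyφ : y ∈ φ.range := by
    have := hφl (QuaternionAlgebra.Basis.self F).j
    rwa [QuaternionAlgebra.Basis.liftHom_apply, show p.lift _ = y by
      simp [QuaternionAlgebra.Basis.lift, p, QuaternionAlgebra.Basis.ofCharTwo]] at this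
  have hzφ : z ∈ φ.range := by
    have := hφr (QuaternionAlgebra.Basis.self F).i
    rwa [QuaternionAlgebra.Basis.liftHom_apply, show q.lift _ = z by
      simp [QuaternionAlgebra.Basis.lift, q, QuaternionAlgebra.Basis.ofCharTwo]] at this
  have huφ : u ∈ φ.range := by
    have := hφr (QuaternionAlgebra.Basis.self F).j
    rwa [QuaternionAlgebra.Basis.liftHom_apply, show q.lift _ = u by
      simp [QuaternionAlgebra.Basis.lift, q, QuaternionAlgebra.Basis.ofCharTwo]] at this
  let f := Algebra.linearMap F A
  have hf (w : A) (v) : f v * w = w * f v := Algebra.commutes v w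
  let g := (((f.addMulRight z).addMulRight u).addMulRight x).addMulRight y
  have hg : Function.Injective g := by
    refine LinearMap.addMulRight_injective (LinearMap.addMulRight_injective
      (LinearMap.addMulRight_injective (LinearMap.addMulRight_injective
        (algebraMap F A).injective hu0 (by rw [add_comm, hzu]) (hf u)) hu0 hzu ?_)
        hy0 (by rw [add_comm, hxy]) ?_) hy0 hxy ?_
    · exact LinearMap.addMulRight_mul_comm (hf _) rfl
    · exact LinearMap.addMulRight_mul_comm (LinearMap.addMulRight_mul_comm (hf _) hyz.symm)
        hyu.symm
    · exact LinearMap.addMulRight_mul_comm (LinearMap.addMulRight_mul_comm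
        (LinearMap.addMulRight_mul_comm (hf _) hxz.symm) hxu.symm) rfl
  have hgs : Function.Surjective g := by
    refine (LinearMap.injective_iff_surjective_of_finrank_eq_finrank ?_).1 hg
    simp [hdim]
  have hφs : Function.Surjective φ := by
    intro t
    obtain ⟨v, rfl⟩ := hgs t
    exact LinearMap.addMulRight_mem (LinearMap.addMulRight_mem (LinearMap.addMulRight_mem
      (LinearMap.addMulRight_mem (fun r => φ.range.algebraMap_mem r) hzφ) huφ) hxφ) hyφ v
  have hφi : Function.Injective φ := by
    refine (LinearMap.injective_iff_surjective_of_finrank_eq_finrank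
      (f := φ.toLinearMap) ?_).2 hφs
    rw [hdim, Module.finrank_tensorProduct, QuaternionAlgebra.finrank_eq_four,
      QuaternionAlgebra.finrank_eq_four]
  let e := AlgEquiv.ofBijective φ ⟨hφi, hφs⟩
  let : StarRing F := starRingOfComm
  have : TrivialStar F := ⟨fun _ => rfl⟩
  have : StarModule F ℍ[F,a,1,b] := ⟨fun r s => by
    ext <;> simp [mul_add]⟩
  have : StarModule F ℍ[F,c,1,d] := ⟨fun r s => by
    ext <;> simp [mul_add]⟩
  refine ⟨{ toFun := fun t => e (star (e.symm t)), map_add' := ?_, map_smul' := ?_ }, ?_, ?_⟩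
  · intro s t; simp
  · intro r t; simp
  · intro s t; simp
  · intro t; simp

end Involution

section Centralizers

variable {F A : Type*} [Field F] [DivisionRing A] [Algebra F A]

theorem exists_commutator_ne_zero [CharP A 2]
    (hcenter : ∀ c : A, (∀ t, c * t = t * c) → c ∈ Set.range (algebraMap F A))
    {x : A} (hx' : x ∉ Set.range (algebraMap F A)) : ∃ t, x * t + t * x ≠ 0 := by
  by_contra! h
  exact hx' (hcenter x fun t => CharTwo.add_eq_zero.1 (h t))

/-- The centralizer of the centralizer of a noncentral Artin–Schreier element `x` is `F[x]`. -/
theorem exists_eq_of_commute_centralizer [CharP A 2]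
    (hcenter : ∀ c : A, (∀ t, c * t = t * c) → c ∈ Set.range (algebraMap F A))
    {x u : A} {a : F} (hx : x * x = x + algebraMap F A a)
    (hx' : x ∉ Set.range (algebraMap F A)) (hu : ∀ c, c * x = x * c → u * c = c * u) :
    ∃ p f : F, u = algebraMap F A p * x + algebraMap F A f := by
  have h2 : (2 : A) = 0 := CharTwo.two_eq_zero
  obtain ⟨t, hd⟩ := exists_commutator_ne_zero hcenter hx'
  have ha := Algebra.commutes (A := A) a
  have hxd := mul_commutator_add hx (ha t)
  set d := x * t + t * x
  have hdx : d * x = x * d + d := by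
    linear_combination (norm := noncomm_ring) hxd - h2 * (x * d)
  have hdix := inv_mul_eq_add_one_mul_inv hd hxd
  have hddi : d * d⁻¹ = 1 := mul_inv_cancel₀ hd
  have hdid : d⁻¹ * d = 1 := inv_mul_cancel₀ hd
  have hdd : u * (d * d) = d * d * u := by
    apply hu
    linear_combination (norm := noncomm_ring) d * hdx + hdx * d + h2 * (d * d)
  obtain ⟨p, hp⟩ := hcenter (u + d * u * d⁻¹) <| by
    refine commute_all_of_commute hx ha hd hxd (fun c hc => ?_) ?_
    · have h := hu (d⁻¹ * c * d) <| by
        rw [mul_assoc, hdx]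
        linear_combination (norm := noncomm_ring) d⁻¹ * hc * d + hdix * (c * d)
          + h2 * (d⁻¹ * c * d)
      linear_combination (norm := noncomm_ring) hu c hc + d * h * d⁻¹ - d * u * d⁻¹ * c * hddi
        + hddi * c * d * u * d⁻¹
    · linear_combination (norm := noncomm_ring) d * u * hdid + hdd * d⁻¹ - u * d * hddi
  have hpc := Algebra.commutes (A := A) p
  obtain ⟨f, hf⟩ := hcenter (u + algebraMap F A p * x) <| by
    refine commute_all_of_commute hx ha hd hxd (fun c hc => ?_) ?_
    · linear_combination (norm := noncomm_ring) hu c hc - algebraMap F A p * hc + hpc c * x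
    · have h : algebraMap F A p * d = u * d + d * u := by
        linear_combination (norm := noncomm_ring) hp * d + d * u * hdid
      linear_combination (norm := noncomm_ring) h + algebraMap F A p * hxd + hpc d * x
        + h2 * (u * d) - h2 * (algebraMap F A p * d * x)
  exact ⟨p, f, by linear_combination (norm := noncomm_ring) -hf - h2 * (algebraMap F A p * x)⟩

theorem mem_range_of_sq_eq [CharP A 2] {x u : A} {a b p f : F}
    (hx : x * x = x + algebraMap F A a)
    (hx' : x ∉ Set.range (algebraMap F A)) (hu : u * u = algebraMap F A b)
    (h : u = algebraMap F A p * x + algebraMap F A f) : u ∈ Set.range (algebraMap F A) := by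
  have h2 : (2 : A) = 0 := CharTwo.two_eq_zero
  rcases eq_or_ne p 0 with rfl | hp
  · exact ⟨f, by simp [h]⟩
  refine absurd ⟨(b + f * f) / (p * p) + a, ?_⟩ hx'
  have hpp : algebraMap F A (p * p) ≠ 0 := by simpa using hp
  have hpc := Algebra.commutes (A := A) p x
  have hfc := Algebra.commutes (A := A) f x
  have hpf := Algebra.commutes (A := A) p (algebraMap F A f)
  apply mul_left_cancel₀ hpp
  rw [← map_mul, mul_add, mul_div_cancel₀ _ (by simpa using hp)]
  simp only [map_add, map_mul]
  rw [h] at hu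
  set P := algebraMap F A p
  set f' := algebraMap F A f
  linear_combination (norm := noncomm_ring) hu + P * hpc * x + P * hfc + hpf * x - P * P * hx
    + h2 * (algebraMap F A b - P * P * x - P * f' * x)

/-- An involution of `A` can be chosen to send `x` to `x + 1` and to fix `u`. -/
theorem exists_involution_eq_add_one [CharP A 2]
    (hcenter : ∀ c : A, (∀ t, c * t = t * c) → c ∈ Set.range (algebraMap F A))
    (h : ∃ τ : A →ₗ[F] A, (∀ a b, τ (a * b) = τ b * τ a) ∧ ∀ a, τ (τ a) = a)
    {x u : A} {a b : F} (hx : x * x = x + algebraMap F A a) (hu : u * u = algebraMap F A b)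
    (hx' : x ∉ Set.range (algebraMap F A)) (hu' : u ∉ Set.range (algebraMap F A))
    (hcomm : x * u = u * x) :
    ∃ τ : A →ₗ[F] A, (∀ a b, τ (a * b) = τ b * τ a) ∧ (∀ a, τ (τ a) = a) ∧
      τ x = x + 1 ∧ τ u = u := by
  have h2 : (2 : A) = 0 := CharTwo.two_eq_zero
  obtain ⟨τ, hmul, hinv⟩ := h
  have hone : τ 1 = 1 := by simpa [hinv] using (hmul (τ 1) 1).symm
  have hF (r : F) : τ (algebraMap F A r) = algebraMap F A r := by
    rw [Algebra.algebraMap_eq_smul_one, map_smul, hone]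
  have ha := Algebra.commutes (A := A) a
  have hb := Algebra.commutes (A := A) b
  have hτx : τ x * τ x = τ x + algebraMap F A a := by rw [← hmul, hx, map_add, hF]
  have hτu : τ u * τ u = algebraMap F A b := by rw [← hmul, hu, hF]
  have hτxu : τ x * τ u = τ u * τ x := by rw [← hmul, ← hmul, hcomm]
  obtain ⟨v, hv0, hvx⟩ : ∃ v : A, v ≠ 0 ∧ v * τ x = (x + 1) * v := by
    obtain ⟨t, ht⟩ : ∃ t, t * τ x + x * t ≠ 0 := by
      by_contra! hall
      have h1 : τ x = x := by simpa using CharTwo.add_eq_zero.1 (hall 1)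
      refine hx' (hcenter x fun t => ?_)
      have := CharTwo.add_eq_zero.1 (hall t)
      rw [← this, h1]
    refine ⟨_, ht, ?_⟩
    linear_combination (norm := noncomm_ring) t * hτx - hx * t - ha t - h2 * (x * t)
  have hvi : v⁻¹ * v = 1 := inv_mul_cancel₀ hv0
  have hvi' : v * v⁻¹ = 1 := mul_inv_cancel₀ hv0
  obtain ⟨s, hs0, hsx, hsu⟩ : ∃ s : A, s ≠ 0 ∧ s * x = x * s ∧ s * (v * τ u * v⁻¹) = u * s := by
    set u' := v * τ u * v⁻¹ with hu'_def
    have hu'v : u' * v = v * τ u := by rw [hu'_def, mul_assoc, hvi, mul_one]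
    have hu'u' : u' * u' = algebraMap F A b := by
      apply mul_right_cancel₀ hv0
      rw [mul_assoc, hu'v, ← mul_assoc, hu'v, mul_assoc, hτu, hb]
    have hu'x : u' * x = x * u' := by
      apply mul_right_cancel₀ hv0
      linear_combination (norm := noncomm_ring) - u' * hvx + hu'v * τ x - v * hτxu
        + hvx * τ u - (x + 1) * hu'v
    obtain ⟨t, htx, ht⟩ : ∃ t, t * x = x * t ∧ t * u' + u * t ≠ 0 := by
      by_contra! hall
      have h1 : u' = u := by simpa using CharTwo.add_eq_zero.1 (hall 1 (by simp))
      obtain ⟨p, f, hpf⟩ := exists_eq_of_commute_centralizer (u := u) hcenter hx hx' fun t ht => by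
        have := CharTwo.add_eq_zero.1 (hall t ht)
        rw [← this, h1]
      exact hu' (mem_range_of_sq_eq hx hx' hu hpf)
    refine ⟨_, ht, ?_, ?_⟩
    · linear_combination (norm := noncomm_ring) t * hu'x + htx * u' + u * htx - hcomm * t
    · linear_combination (norm := noncomm_ring) t * hu'u' - hu * t - hb t
  have hwx : s * v * τ x = (x + 1) * (s * v) := by
    linear_combination (norm := noncomm_ring) s * hvx + hsx * v
  have hwu : s * v * τ u = u * (s * v) := by
    linear_combination (norm := noncomm_ring) hsu * v - s * v * τ u * hvi
  have hw0 : s * v ≠ 0 := mul_ne_zero hs0 hv0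
  obtain ⟨w, hw0, hwx, hwu, hτw⟩ :
      ∃ w : A, w ≠ 0 ∧ w * τ x = (x + 1) * w ∧ w * τ u = u * w ∧ τ w = w := by
    set w := s * v
    by_cases hsum : w + τ w = 0
    · exact ⟨w, hw0, hwx, hwu, (CharTwo.add_eq_zero.1 hsum).symm⟩
    have hwx' := congrArg τ hwx
    have hwu' := congrArg τ hwu
    simp only [hmul, hinv, map_add, hone] at hwx' hwu'
    refine ⟨_, hsum, ?_, ?_, by rw [map_add, hinv, add_comm]⟩
    · linear_combination (norm := noncomm_ring) hwx - hwx' - h2 * τ w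
    · linear_combination (norm := noncomm_ring) hwu - hwu'
  have hwi : w⁻¹ * w = 1 := inv_mul_cancel₀ hw0
  have hwi' : w * w⁻¹ = 1 := mul_inv_cancel₀ hw0
  have hτwi : τ w⁻¹ = w⁻¹ := by
    apply eq_inv_of_mul_eq_one_left
    nth_rw 2 [← hτw]
    rw [← hmul, hwi', hone]
  refine ⟨(LinearMap.mulLeftRight F (w, w⁻¹)).comp τ, fun s t => ?_, fun t => ?_, ?_, ?_⟩
  · simp only [LinearMap.comp_apply, LinearMap.mulLeftRight_apply, hmul]
    linear_combination (norm := noncomm_ring) - w * τ t * hwi * τ s * w⁻¹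
  · simp only [LinearMap.comp_apply, LinearMap.mulLeftRight_apply, hmul, hinv, hτw, hτwi]
    linear_combination (norm := noncomm_ring) hwi' * t * w * w⁻¹ + t * hwi'
  · simp only [LinearMap.comp_apply, LinearMap.mulLeftRight_apply, hwx, mul_assoc, hwi', mul_one]
  · simp only [LinearMap.comp_apply, LinearMap.mulLeftRight_apply, hwu, mul_assoc, hwi', mul_one]

/-- The centralizer of `x`, `u`, `z` is `F[x]` when `zu + uz = u`. -/
theorem exists_eq_of_commute [CharP A 2] (hdim : Module.finrank F A = 16) {x z u d : A}
    (hx' : x ∉ Set.range (algebraMap F A)) (hu0 : u ≠ 0) (hd0 : d ≠ 0)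
    (hzu : z * u + u * z = u) (hzx : z * x = x * z) (hux : u * x = x * u)
    (hxd : x * d + d * x = d) {n : A} (hnx : n * x = x * n) (hnu : n * u = u * n)
    (hnz : n * z = z * n) :
    ∃ p f : F, n = algebraMap F A p * x + algebraMap F A f := by
  have : FiniteDimensional F A := .of_finrank_pos (by omega)
  let E := Subalgebra.centralizer F {x, u, z}
  have hE {e : A} : e ∈ E ↔ e * x = x * e ∧ e * u = u * e ∧ e * z = z * e := by
    simp [E, Subalgebra.mem_centralizer_iff, eq_comm (b := e * _)]
  let f := E.toSubmodule.subtype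
  have hfE (v) : f v * x = x * f v ∧ f v * u = u * f v ∧ f v * z = z * f v := hE.1 v.2
  let g := ((f.addMulRight u).addMulRight z).addMulRight d
  have hg : Function.Injective g := by
    refine LinearMap.addMulRight_injective (LinearMap.addMulRight_injective
      (LinearMap.addMulRight_injective (Submodule.subtype_injective _) hu0 hzu
        fun v => (hfE v).2.2) hu0 (by rw [add_comm, hzu]) ?_) hd0 hxd ?_
    · exact LinearMap.addMulRight_mul_comm (fun v => (hfE v).2.1) rfl
    · exact LinearMap.addMulRight_mul_comm
        (LinearMap.addMulRight_mul_comm (fun v => (hfE v).1) hux) hzx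
  have hle : Module.finrank F E.toSubmodule ≤ 2 := by
    have := LinearMap.finrank_le_finrank_of_injective hg
    simp only [Module.finrank_prod, hdim] at this
    omega
  have hxE : x ∈ E := hE.2 ⟨rfl, hux.symm, hzx.symm⟩
  have hli : LinearIndependent F ![(1 : A), x] := by
    rw [LinearIndependent.pair_iff' one_ne_zero]
    exact fun r hr => hx' ⟨r, by rw [Algebra.algebraMap_eq_smul_one, hr]⟩
  have hsub : Submodule.span F {1, x} ≤ E.toSubmodule := by
    rw [Submodule.span_le]
    rintro _ (rfl | rfl)
    exacts [one_mem E, hxE]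
  have hspan : Submodule.span F {1, x} = E.toSubmodule := by
    refine Submodule.eq_of_le_of_finrank_le hsub (hle.trans ?_)
    have := finrank_span_eq_card hli
    rw [Matrix.range_cons_cons_empty, Fintype.card_fin] at this
    exact this.ge
  have hn : n ∈ Submodule.span F {1, x} := by
    rw [hspan]; exact hE.2 ⟨hnx, hnu, hnz⟩
  obtain ⟨r, p, rfl⟩ := Submodule.mem_span_pair.1 hn
  exact ⟨p, r, by rw [← Algebra.smul_def, Algebra.algebraMap_eq_smul_one, add_comm]⟩

/-- If `zu + uz = u` and `x` is not central but commutes with `z` and `u`, then some element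
commuting with `z` and `u` does not commute with `x`. -/
theorem exists_commute_commutator_ne_zero [CharP A 2]
    (hcenter : ∀ c : A, (∀ t, c * t = t * c) → c ∈ Set.range (algebraMap F A))
    {x z u : A} {b c : F} (hx' : x ∉ Set.range (algebraMap F A)) (hu0 : u ≠ 0)
    (hu : u * u = algebraMap F A b) (hz : z * z = z + algebraMap F A c)
    (hzu : z * u + u * z = u) (hxz : x * z = z * x) (hxu : x * u = u * x) :
    ∃ t, t * z = z * t ∧ t * u = u * t ∧ x * t + t * x ≠ 0 := by
  have h2 : (2 : A) = 0 := CharTwo.two_eq_zero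
  by_contra! hall
  have hall' (t : A) (htz : t * z = z * t) (htu : t * u = u * t) : x * t = t * x :=
    CharTwo.add_eq_zero.1 (hall t htz htu)
  have huz : u * z = z * u + u := by
    linear_combination (norm := noncomm_ring) hzu - h2 * (z * u)
  have hui : u⁻¹ * z = (z + 1) * u⁻¹ := inv_mul_eq_add_one_mul_inv hu0 hzu
  have huui : u * u⁻¹ = 1 := mul_inv_cancel₀ hu0
  have huiu : u⁻¹ * u = 1 := inv_mul_cancel₀ hu0
  refine hx' (hcenter x (commute_all_of_commute hz (Algebra.commutes c) hu0 hzu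
    (fun t ht => ?_) hxu))
  obtain ⟨s, hs⟩ : ∃ s, s = u * t * u⁻¹ + t := ⟨_, rfl⟩
  have hsu : s * u = u * t + t * u := by
    linear_combination (norm := noncomm_ring) hs * u + u * t * huiu
  have hsz : s * z = z * s := by
    linear_combination (norm := noncomm_ring) u * t * hui + u * ht * u⁻¹ + huz * t * u⁻¹
      + ht + h2 * (u * t * u⁻¹) + hs * z - z * hs
  have hsu' : s * u = u * s := by
    linear_combination (norm := noncomm_ring) hsu - hu * t * u⁻¹ - Algebra.commutes b t * u⁻¹
      + t * hu * u⁻¹ - t * u * huui - u * hs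
  have h1 := hall' s hsz hsu'
  have h0 := hall' (t + s * z) (by
    linear_combination (norm := noncomm_ring) ht + hsz * z) (by
    linear_combination (norm := noncomm_ring) - s * huz + hsu' * z + hsu + h2 * (t * u - s * u))
  linear_combination (norm := noncomm_ring) h0 - h1 * z - s * hxz

end Centralizers


/-- If `x` is an Artin–Schreier element and `u` a square-central element of a biquaternion
division algebra, both outside `F·1` and commuting with each other, then they fit into a
quadruple of generators `(x, y, z, u)` for some Artin–Schreier element `z` and some
square-central element `y`. -/
theorem exists_quadruple_of_artinSchreier_squareCentral (F A : Type*) [Field F] [CharP F 2]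
    [DivisionRing A] [Algebra F A]
    (hcentral : Subalgebra.center F A = ⊥) (hdim : Module.finrank F A = 16)
    (hbiquat : ∃ q : A × A × A × A, IsQuadruple F q)
    (x u : A) (hx : IsArtinSchreier F x) (hu : IsSquareCentral F u)
    (hx' : x ∉ Set.range (algebraMap F A))
    (hu' : u ∉ Set.range (algebraMap F A))
    (hcomm : x * u = u * x) :
    ∃ z y : A, IsArtinSchreier F z ∧ IsSquareCentral F y ∧ IsQuadruple F (x, y, z, u) := by
  have : CharP A 2 := charP_of_injective_algebraMap (algebraMap F A).injective 2
  have h2 : (2 : A) = 0 := CharTwo.two_eq_zero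
  obtain ⟨a, hxa⟩ := id hx
  obtain ⟨b, hub⟩ := id hu
  have hxx : x * x = x + algebraMap F A a := by
    linear_combination (norm := noncomm_ring) - hxa - h2 * x
  have huu : u * u = algebraMap F A b := by rw [hub, sq]
  have hcenter (c : A) (hc : ∀ t, c * t = t * c) : c ∈ Set.range (algebraMap F A) := by
    rw [← Algebra.mem_bot, ← hcentral, Subalgebra.mem_center_iff]
    exact fun t => (hc t).symm
  have hu0 : u ≠ 0 := by
    rintro rfl
    exact hu' ⟨0, map_zero _⟩
  obtain ⟨d₀, hd₀, hxd₀⟩ : ∃ d, d ≠ 0 ∧ x * d + d * x = d := by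
    obtain ⟨t, ht⟩ := exists_commutator_ne_zero hcenter hx'
    exact ⟨_, ht, mul_commutator_add hxx (Algebra.commutes a t)⟩
  obtain ⟨τ, hmul, hinv, hτx, hτu⟩ := exists_involution_eq_add_one hcenter
    (exists_involution_s5 hdim hbiquat) hxx huu hx' hu' hcomm
  obtain ⟨z₀, hz₀u, hz₀x⟩ : ∃ z, z * u + u * z = u ∧ z * x = x * z := by
    obtain ⟨t, htx, ht⟩ : ∃ t, t * x = x * t ∧ t * u + u * t ≠ 0 := by
      by_contra! hall
      obtain ⟨p, f, hpf⟩ := exists_eq_of_commute_centralizer (u := u) hcenter hxx hx' fun t ht =>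
        (CharTwo.add_eq_zero.1 (hall t ht)).symm
      exact hu' (mem_range_of_sq_eq hxx hx' huu hpf)
    obtain ⟨e, he⟩ : ∃ e, e = t * u + u * t := ⟨_, rfl⟩
    rw [← he] at ht
    have heu : Commute e u := by
      change e * u = u * e
      linear_combination (norm := noncomm_ring) he * u - u * he + t * huu - huu * t
        - Algebra.commutes b t
    have hex : Commute e x := by
      change e * x = x * e
      linear_combination (norm := noncomm_ring) he * x - x * he + htx * u - t * hcomm + u * htx
        - hcomm * t
    have heui : e⁻¹ * u = u * e⁻¹ := heu.inv_left₀
    have hexi : e⁻¹ * x = x * e⁻¹ := hex.inv_left₀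
    refine ⟨t * e⁻¹ * u, ?_, ?_⟩
    · linear_combination (norm := noncomm_ring) t * heui * u - he * e⁻¹ * u
        + mul_inv_cancel₀ ht * u
    · linear_combination (norm := noncomm_ring) htx * e⁻¹ * u + t * hexi * u - t * e⁻¹ * hcomm
  obtain ⟨m, hm⟩ : ∃ m, m = τ z₀ + z₀ := ⟨_, rfl⟩
  have hτz₀u := congrArg τ hz₀u
  have hτz₀x := congrArg τ hz₀x
  simp only [map_add, hmul, hτu, hτx] at hτz₀u hτz₀x
  have hmu : m * u = u * m := by
    linear_combination (norm := noncomm_ring) hm * u - u * hm + hτz₀u + hz₀u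
      - h2 * (u * τ z₀ + u * z₀ - u)
  have hmx : m * x = x * m := by
    linear_combination (norm := noncomm_ring) hm * x - x * hm + hz₀x - hτz₀x
  have hτm : τ m = m := by rw [hm, map_add, hinv, add_comm]
  obtain ⟨z, hz⟩ : ∃ z, z = z₀ + x * m + x := ⟨_, rfl⟩
  have hzu : z * u + u * z = u := by
    linear_combination (norm := noncomm_ring) hz * u + u * hz + hz₀u + x * hmu + hcomm * m
      + hcomm + h2 * (u * x * m + u * x)
  have hzx : z * x = x * z := by
    linear_combination (norm := noncomm_ring) hz * x - x * hz + hz₀x + x * hmx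
  have hτz : τ z = z + 1 := by
    have := congrArg τ hz
    simp only [map_add, hmul, hτm, hτx] at this
    linear_combination (norm := noncomm_ring) this - hz - hm + hmx + h2 * (m - z₀)
  have hone : τ 1 = 1 := by simpa [hinv] using (hmul (τ 1) 1).symm
  have hF (r : F) : τ (algebraMap F A r) = algebraMap F A r := by
    rw [Algebra.algebraMap_eq_smul_one, map_smul, hone]
  have hcent {n : A} := exists_eq_of_commute (n := n) hdim hx' hu0 hd₀ hzu hzx hcomm.symm hxd₀
  have huz : u * z = z * u + u := by
    linear_combination (norm := noncomm_ring) hzu - h2 * (z * u)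
  have hzAS : IsArtinSchreier F z := by
    obtain ⟨p, f, hpf⟩ := hcent (n := z ^ 2 + z)
      (by linear_combination (norm := noncomm_ring) z * hzx + hzx * z + hzx)
      (by linear_combination (norm := noncomm_ring) - z * huz - huz * z - h2 * (u * z))
      (by noncomm_ring)
    have hτ := congrArg τ hpf
    rw [map_add, sq, hmul, hτz, map_add, hmul, hτx, hF, hF] at hτ
    have hp : algebraMap F A p = 0 := by
      linear_combination (norm := noncomm_ring) hpf - hτ + h2 * (z + 1)
        + Algebra.commutes p x
    exact ⟨f, by rw [hpf, hp, zero_mul, zero_add]⟩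
  obtain ⟨c, hzc⟩ := id hzAS
  obtain ⟨t, htz, htu, ht⟩ := exists_commute_commutator_ne_zero (z := z) (c := c) hcenter hx' hu0
    huu (by linear_combination (norm := noncomm_ring) - hzc - h2 * z) hzu hzx.symm hcomm
  have hxy := mul_commutator_add hxx (Algebra.commutes a t)
  obtain ⟨y, hy⟩ : ∃ y, y = x * t + t * x := ⟨_, rfl⟩
  rw [← hy] at hxy ht
  have hyz : y * z = z * y := by
    linear_combination (norm := noncomm_ring) hy * z - z * hy + x * htz - hzx * t + t * (-hzx)
      + htz * x
  have hyu : y * u = u * y := by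
    linear_combination (norm := noncomm_ring) hy * u - u * hy + x * htu + hcomm * t + t * hcomm
      + htu * x
  have hyx : y * x = x * y + y := by
    linear_combination (norm := noncomm_ring) hxy - h2 * (x * y)
  have hySC : IsSquareCentral F y := by
    obtain ⟨p, f, hpf⟩ := hcent (n := y ^ 2)
      (by linear_combination (norm := noncomm_ring) y * hyx + hyx * y + h2 * (y * y))
      (by linear_combination (norm := noncomm_ring) y * hyu + hyu * y)
      (by linear_combination (norm := noncomm_ring) y * hyz + hyz * y)
    have hpy : algebraMap F A p * y = 0 := by
      linear_combination (norm := noncomm_ring) hpf * y - y * hpf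
        - algebraMap F A p * hyx + Algebra.commutes p y * x + Algebra.commutes f y
    have hp := (mul_eq_zero.1 hpy).resolve_right ht
    exact ⟨f, by rw [hpf, hp, zero_mul, zero_add]⟩
  exact ⟨z, y, hzAS, hySC, ht, hu0, hx, hySC, hzAS, hu, hxy, hzx.symm, hcomm, hyz, hyu, hzu⟩
end

section
/- If y and y' are square-central elements of A with yy' ≠ y'y, then the F-subalgebra B = F[y, y'] generated by y and y' is a quaternion algebra over its center: the center K of B satisfies dim_F K ≤ 2 (K is either F·1 or a quadratic field extension of F) and B is a central simple K-algebra with dim_K B = 4; in particular, there exists w ∈ A with w ∉ F·1 such that w is either Artin–Schreier or square-central and w commutes with both y and y'. -/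
/-- In characteristic two, the commutator `y * y' + y' * y` commutes with a square-central `y`. -/
theorem commute_mul_add_mul_left {R : Type*} [Ring R] [CharP R 2] {y y' : R}
    (h : Commute (y ^ 2) y') : Commute (y * y' + y' * y) y := by
  have h' : y * y * y' = y' * (y * y) := by simpa [pow_two] using h.eq
  change (y * y' + y' * y) * y = y * (y * y' + y' * y)
  rw [add_mul, mul_add, ← mul_assoc y y y', h', mul_assoc y' y y, mul_assoc y y' y, add_comm]

/-- In a domain, if `y` and `y'` do not commute, then `1, y, y', y * y'` are linearly independent over the centralizer of `{y, y'}`. -/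
theorem coeffs_eq_zero {R : Type*} [Ring R] [NoZeroDivisors R] {y y' : R}
    (hne : y * y' ≠ y' * y) {c₀ c₁ c₂ c₃ : R}
    (h₀ : Commute c₀ y) (h₀' : Commute c₀ y') (h₁ : Commute c₁ y) (h₁' : Commute c₁ y')
    (h₂ : Commute c₂ y) (h₂' : Commute c₂ y') (h₃ : Commute c₃ y) (h₃' : Commute c₃ y')
    (h : c₀ + c₁ * y + c₂ * y' + c₃ * (y * y') = 0) :
    c₀ = 0 ∧ c₁ = 0 ∧ c₂ = 0 ∧ c₃ = 0 := by
  have hs : y * y' - y' * y ≠ 0 := sub_ne_zero.mpr hne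
  have key {p q : R} (hp : Commute p y') (hq : Commute q y') (hpq : p + q * y = 0) :
      p = 0 ∧ q = 0 := by
    have hq0 : q * (y * y' - y' * y) = (p + q * y) * y' - y' * (p + q * y) := by
      rw [add_mul, mul_add, hp.eq, ← mul_assoc y' q y, ← hq.eq]
      noncomm_ring
    rw [hpq, zero_mul, mul_zero, sub_zero] at hq0
    obtain rfl := (mul_eq_zero.mp hq0).resolve_right hs
    exact ⟨by simpa using hpq, rfl⟩
  have h23 : (c₂ + c₃ * y) * (y * y' - y' * y) = 0 := by
    have e : (c₂ + c₃ * y) * (y * y' - y' * y) =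
        y * (c₀ + c₁ * y + c₂ * y' + c₃ * (y * y')) -
          (c₀ + c₁ * y + c₂ * y' + c₃ * (y * y')) * y := by
      simp only [mul_add, ← mul_assoc, ← h₀.eq, ← h₁.eq, ← h₂.eq, ← h₃.eq]
      noncomm_ring
    rw [e, h, mul_zero, zero_mul, sub_zero]
  obtain ⟨rfl, rfl⟩ := key h₂' h₃' ((mul_eq_zero.mp h23).resolve_right hs)
  obtain ⟨rfl, rfl⟩ := key h₀' h₁' (by simpa using h)
  simp

/-- The centralizer of a non-central element of a division algebra has at most half the dimension
of the algebra. -/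
theorem two_mul_finrank_centralizer_le {F A : Type*} [Field F] [DivisionRing A] [Algebra F A]
    [FiniteDimensional F A] {w : A} (hw : w ∉ Subalgebra.center F A) :
    2 * Module.finrank F (Subalgebra.centralizer F {w}) ≤ Module.finrank F A := by
  have : ∃ a, ¬ Commute w a := by
    by_contra! hc
    exact hw (Subalgebra.mem_center_iff.mpr fun b => ((hc b).eq).symm)
  obtain ⟨a, ha⟩ := this
  let D := Subalgebra.centralizer F {w}
  have hD {d : A} (hd : d ∈ D) : Commute w d := by
    exact Subalgebra.mem_centralizer_iff F |>.mp hd w rfl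
  let f : (D × D) →ₗ[F] A := LinearMap.coprod D.val.toLinearMap
    ((LinearMap.mulRight F a).comp D.val.toLinearMap)
  have hf : Function.Injective f := by
    rw [← LinearMap.ker_eq_bot, LinearMap.ker_eq_bot']
    rintro ⟨⟨d, hd⟩, ⟨e, he⟩⟩ h
    replace h : d + e * a = 0 := by simpa [f] using h
    have he0 : e = 0 := by
      by_contra he0
      apply ha
      have : a = e⁻¹ * (-d) := by
        rw [eq_inv_mul_iff_mul_eq₀ he0]; exact eq_neg_of_add_eq_zero_right h
      rw [this]
      exact (hD he).inv_right₀.mul_right (hD hd).neg_right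
    subst he0
    have hd0 : d = 0 := by simpa using h
    subst hd0
    rfl
  have := LinearMap.finrank_le_finrank_of_injective hf
  rw [Module.finrank_prod] at this
  change 2 * Module.finrank F D ≤ _
  lia

/-- A subspace `E` of the centralizer of `{w, y, y'}` has at most a quarter of the dimension of
the centralizer of `w`, when `w` commutes with the non-commuting elements `y` and `y'`. -/
theorem four_mul_finrank_le_finrank_centralizer {F A : Type*} [Field F]
    [DivisionRing A] [Algebra F A] [FiniteDimensional F A] {y y' w : A}
    (hne : y * y' ≠ y' * y) (hwy : Commute w y) (hwy' : Commute w y') (E : Submodule F A)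
    (hE : ∀ e ∈ E, Commute e y ∧ Commute e y' ∧ Commute w e) :
    4 * Module.finrank F E ≤ Module.finrank F (Subalgebra.centralizer F {w}) := by
  let g : (E × E × E × E) →ₗ[F] A :=
    E.subtype.coprod (((LinearMap.mulRight F y).comp E.subtype).coprod
      (((LinearMap.mulRight F y').comp E.subtype).coprod
        ((LinearMap.mulRight F (y * y')).comp E.subtype)))
  have hg (a b c d : E) : g (a, b, c, d) = a + b * y + c * y' + d * (y * y') := by
    simp [g, add_assoc, mul_assoc]
  let f : (E × E × E × E) →ₗ[F] (Subalgebra.toSubmodule (Subalgebra.centralizer F {w})) :=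
    g.codRestrict _ <| by
      rintro ⟨a, b, c, d⟩
      rw [hg, Subalgebra.mem_toSubmodule, Subalgebra.mem_centralizer_iff]
      rintro _ rfl
      exact ((((hE a a.2).2.2.add_right ((hE b b.2).2.2.mul_right hwy)).add_right
        ((hE c c.2).2.2.mul_right hwy')).add_right
        ((hE d d.2).2.2.mul_right (hwy.mul_right hwy'))).eq
  have hf : Function.Injective f := by
    rw [← LinearMap.ker_eq_bot, LinearMap.ker_eq_bot']
    rintro ⟨a, b, c, d⟩ h
    replace h : (a : A) + b * y + c * y' + d * (y * y') = 0 := by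
      rw [← hg]; exact congrArg Subtype.val h
    obtain ⟨h0, h1, h2, h3⟩ := coeffs_eq_zero hne (hE a a.2).1 (hE a a.2).2.1 (hE b b.2).1
      (hE b b.2).2.1 (hE c c.2).1 (hE c c.2).2.1 (hE d d.2).1 (hE d d.2).2.1 h
    simp only [ZeroMemClass.coe_eq_zero] at h0 h1 h2 h3
    simp [h0, h1, h2, h3]
  have := LinearMap.finrank_le_finrank_of_injective hf
  simp only [Module.finrank_prod] at this
  change 4 * Module.finrank F E ≤ Module.finrank F (Subalgebra.toSubmodule (Subalgebra.centralizer F {w}))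
  lia

/-- In a central division algebra of dimension 16, a subspace of pairwise commuting elements
centralizing two non-commuting elements has dimension at most `2`. -/
theorem finrank_le_two_of_commute {F A : Type*} [Field F] [DivisionRing A]
    [Algebra F A] (hcentral : Subalgebra.center F A = ⊥) (hdim : Module.finrank F A = 16)
    {y y' : A} (hne : y * y' ≠ y' * y) (E : Submodule F A)
    (hE : ∀ e ∈ E, Commute e y ∧ Commute e y') (hcomm : ∀ e ∈ E, ∀ e' ∈ E, Commute e e') :
    Module.finrank F E ≤ 2 := by
  have : FiniteDimensional F A := Module.finite_of_finrank_pos (by lia)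
  by_cases h : E ≤ Subalgebra.toSubmodule (⊥ : Subalgebra F A)
  · have h1 := Submodule.finrank_mono h
    rw [Subalgebra.finrank_toSubmodule, Subalgebra.finrank_bot] at h1
    lia
  · obtain ⟨w, hwE, hw⟩ := Set.not_subset.mp h
    have h1 := two_mul_finrank_centralizer_le (F := F) (w := w) (by rw [hcentral]; exact hw)
    have h2 := four_mul_finrank_le_finrank_centralizer hne (hE w hwE).1 (hE w hwE).2 E
      fun e he => ⟨(hE e he).1, (hE e he).2, hcomm w hwE e he⟩
    lia

/-- If every element commuting with the square-central elements `y` and `y'` is a scalar, and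
`y * y' + y' * y` is a nonzero scalar, then `A` has dimension at most `4`. -/
theorem finrank_le_four_of_centralizer {F A : Type*} [Field F] [Ring A]
    [Algebra F A] [CharP A 2] {y y' : A} (hy : IsSquareCentral F y) (hy' : IsSquareCentral F y')
    {σ : F} (hσ0 : σ ≠ 0) (hσ : algebraMap F A σ = y * y' + y' * y)
    (hC : ∀ c : A, Commute c y → Commute c y' → c ∈ Set.range (algebraMap F A)) :
    Module.finrank F A ≤ 4 := by
  have hcs (z : A) (hz : IsSquareCentral F z) (a : A) : Commute (z * a + a * z) z := by
    obtain ⟨r, hr⟩ := hz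
    exact commute_mul_add_mul_left (hr ▸ Algebra.commutes r a)
  have shift (z z' a c : A) (h : algebraMap F A σ = z * z' + z' * z) (hc : Commute c z)
      (ha : z * a + a * z = c) : Commute (a + σ⁻¹ • (z' * c)) z := by
    change _ * _ = _ * _
    rw [← sub_eq_zero, CharTwo.sub_eq_add]
    have e1 : z * (z' * c) + z' * c * z = σ • c := by
      rw [mul_assoc z' c z, hc.eq, Algebra.smul_def, h]; noncomm_ring
    calc _ = (z * a + a * z) + σ⁻¹ • (z * (z' * c) + z' * c * z) := by
          simp only [add_mul, mul_add, smul_mul_assoc, mul_smul_comm, smul_add]; abel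
      _ = 0 := by
          rw [e1, smul_smul, inv_mul_cancel₀ hσ0, one_smul, ha, CharTwo.add_self_eq_zero]
  have half (e : A) (he : Commute e y) : ∃ p q : F, e = p • 1 + q • y := by
    set d := y' * e + e * y' with hd
    have hdy' : Commute d y' := hcs y' hy' e
    have hdy : Commute d y := by
      have e1 : d * y - y * d = e * algebraMap F A σ - algebraMap F A σ * e := by
        rw [hσ, hd]
        have h1 : y' * e * y = y' * y * e := by rw [mul_assoc, he.eq, mul_assoc]
        have h2 : y * (e * y') = e * (y * y') := by rw [← mul_assoc, ← he.eq, mul_assoc]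
        have h3 : e * (y' * y) = e * y' * y := by rw [mul_assoc]
        have h4 : ∀ a b c d : A, a + b - (c + d) = (d + b) - (c + a) := by
          intro a b c d
          simp only [CharTwo.sub_eq_add]; abel
        rw [add_mul, mul_add, mul_add, add_mul, h1, h2, h3, h4, mul_assoc y y' e]
      rw [← Algebra.commutes, sub_self] at e1
      exact sub_eq_zero.mp e1
    have hey' := shift y' y e d (by rw [hσ, add_comm]) hdy' rfl
    obtain ⟨q, hq⟩ := hC d hdy hdy'
    obtain ⟨p, hp⟩ := hC _ (he.add_left (((Commute.refl y).mul_left hdy).smul_left _)) hey'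
    refine ⟨p, σ⁻¹ * q, ?_⟩
    rw [← Algebra.algebraMap_eq_smul_one, hp, ← hq, ← Algebra.commutes, ← Algebra.smul_def,
      smul_smul, add_assoc, CharTwo.add_self_eq_zero, add_zero]
  have hspan : (⊤ : Submodule F A) = Submodule.span F (Set.range ![1, y, y', y' * y]) := by
    refine (eq_top_iff.mpr fun a _ => ?_).symm
    obtain ⟨p, q, hpq⟩ := half _ (hcs y hy a)
    obtain ⟨p', q', hpq'⟩ := half _ (shift y y' a _ hσ (hcs y hy a) rfl)
    have ha : a = p' • 1 + q' • y + (σ⁻¹ * p) • y' + (σ⁻¹ * q) • (y' * y) := by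
      have : a = (a + σ⁻¹ • (y' * (y * a + a * y))) + σ⁻¹ • (y' * (y * a + a * y)) := by
        rw [add_assoc, CharTwo.add_self_eq_zero, add_zero]
      rw [this, hpq', hpq]
      simp only [mul_add, smul_add, mul_smul_comm, mul_one, smul_smul]
      abel
    have hm (i : Fin 4) := Submodule.subset_span (R := F)
      (Set.mem_range_self (f := ![1, y, y', y' * y]) i)
    rw [ha]
    exact add_mem (add_mem (add_mem (Submodule.smul_mem _ _ (hm 0))
      (Submodule.smul_mem _ _ (hm 1))) (Submodule.smul_mem _ _ (hm 2)))
      (Submodule.smul_mem _ _ (hm 3))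
  rw [← finrank_top F A, hspan]
  exact (finrank_range_le_card _).trans (by simp)

/-- An element outside `F` satisfying a quadratic equation yields, up to scaling, an
Artin–Schreier or square-central element. -/
theorem exists_smul_isArtinSchreier_or_isSquareCentral {F A : Type*} [Field F]
    [Ring A] [Algebra F A] [CharP A 2] {w : A} (hw : w ∉ Set.range (algebraMap F A)) {p q : F}
    (h : w ^ 2 = algebraMap F A p + q • w) :
    ∃ r : F, r • w ∉ Set.range (algebraMap F A) ∧
      (IsArtinSchreier F (r • w) ∨ IsSquareCentral F (r • w)) := by
  by_cases hq : q = 0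
  · exact ⟨1, by simpa using hw, Or.inr ⟨p, by simp [h, hq]⟩⟩
  · refine ⟨q⁻¹, ?_, Or.inl ⟨(q⁻¹) ^ 2 * p, ?_⟩⟩
    · rintro ⟨r, hr⟩
      refine hw ⟨q * r, ?_⟩
      rw [map_mul, hr, ← Algebra.smul_def, smul_smul, mul_inv_cancel₀ hq, one_smul]
    · rw [smul_pow, h, smul_add, smul_smul, pow_two, mul_assoc q⁻¹ q⁻¹ q, inv_mul_cancel₀ hq,
        mul_one, add_assoc, CharTwo.add_self_eq_zero, add_zero, Algebra.smul_def, map_mul]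

/-- In a central division algebra of dimension 16, every `w ∉ F` commuting with two non-commuting
elements is quadratic over `F`. -/
theorem exists_sq_eq_of_commute {F A : Type*} [Field F] [DivisionRing A]
    [Algebra F A] (hcentral : Subalgebra.center F A = ⊥) (hdim : Module.finrank F A = 16)
    {y y' w : A} (hne : y * y' ≠ y' * y) (hw : w ∉ Set.range (algebraMap F A))
    (hwy : Commute w y) (hwy' : Commute w y') :
    ∃ p q : F, w ^ 2 = algebraMap F A p + q • w := by
  have : FiniteDimensional F A := Module.finite_of_finrank_pos (by lia)
  let E := Algebra.adjoin F {w}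
  have hEz (z : A) (hz : Commute w z) : ∀ e ∈ E, Commute e z := by
    intro e he
    refine ((Algebra.commute_of_mem_adjoin_singleton_of_commute he hz.symm)).symm
  have h2 : Module.finrank F (Subalgebra.toSubmodule E) ≤ 2 :=
    finrank_le_two_of_commute hcentral hdim hne _
      (fun e he => ⟨hEz y hwy e he, hEz y' hwy' e he⟩)
      fun e he e' he' => hEz e' (hEz w (Commute.refl w) e' he').symm e he
  have hli : LinearIndependent F ![1, w] := by
    rw [LinearIndependent.pair_iff]
    intro s t hst
    have ht : t = 0 := by
      by_contra ht
      refine hw ⟨-(t⁻¹ * s), ?_⟩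
      have h3 : w = t⁻¹ • (t • w) := by rw [smul_smul, inv_mul_cancel₀ ht, one_smul]
      rw [h3, eq_neg_of_add_eq_zero_right hst, Algebra.algebraMap_eq_smul_one, smul_neg, smul_smul,
        neg_smul]
    subst ht
    exact ⟨by simpa using hst, rfl⟩
  have hwE : w ∈ E := Algebra.self_mem_adjoin_singleton F w
  have hle : Submodule.span F (Set.range ![1, w]) ≤ Subalgebra.toSubmodule E := by
    rw [Submodule.span_le]
    rintro _ ⟨i, rfl⟩
    fin_cases i
    · exact one_mem E
    · exact hwE
  have heq := Submodule.eq_of_le_of_finrank_le hle (by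
    rw [finrank_span_eq_card hli]; simpa using h2)
  have hmem : w ^ 2 ∈ Submodule.span F (Set.range ![1, w]) := heq ▸ pow_mem hwE 2
  rw [Matrix.range_cons, Matrix.range_cons, Matrix.range_empty, Set.union_empty,
    Set.singleton_union, Submodule.mem_span_pair] at hmem
  obtain ⟨p, q, hpq⟩ := hmem
  exact ⟨p, q, by rw [← hpq, Algebra.algebraMap_eq_smul_one]⟩

/-- If a domain is generated over `F` by two non-commuting elements `y` and `y'` whose squares lie
in `F`, then it has dimension `4` over its center. -/
theorem finrank_center_eq_four {F B : Type*} [Field F] [CharP F 2] [Ring B] [IsDomain B]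
    [Algebra F B] {y y' : B} (hy : IsSquareCentral F y) (hy' : IsSquareCentral F y')
    (hne : y * y' ≠ y' * y) (htop : Algebra.adjoin F {y, y'} = ⊤) :
    Module.finrank (Subring.center B) B = 4 := by
  have : CharP B 2 := charP_of_injective_algebraMap (algebraMap F B).injective 2
  let K := Subring.center B
  have hK (k : K) (b : B) : Commute (k : B) b := (Subring.mem_center_iff.mp k.2 b).symm
  let v : Fin 4 → B := ![1, y, y', y * y']
  let N := Submodule.span K (Set.range v)
  have hm (i : Fin 4) : v i ∈ N := Submodule.subset_span (Set.mem_range_self i)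
  have hF (r : F) : algebraMap F B r ∈ K :=
    Subring.mem_center_iff.mpr fun b => (Algebra.commutes r b).symm
  have hKN {k n : B} (hk : k ∈ K) (hn : n ∈ N) : k * n ∈ N := N.smul_mem ⟨k, hk⟩ hn
  obtain ⟨a, ha⟩ := hy
  obtain ⟨b, hb⟩ := hy'
  have hs : y * y' + y' * y ∈ K := by
    have h1 : Commute (y * y' + y' * y) y :=
      commute_mul_add_mul_left (ha ▸ Algebra.commutes a y')
    have h2 : Commute (y * y' + y' * y) y' := by
      rw [add_comm]
      exact commute_mul_add_mul_left (hb ▸ Algebra.commutes b y)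
    refine Subring.mem_center_iff.mpr fun z => ?_
    have hz : z ∈ Algebra.adjoin F {y, y'} := htop ▸ Algebra.mem_top
    have : Algebra.adjoin F {y, y'} ≤ Subalgebra.centralizer F {y * y' + y' * y} := by
      refine Algebra.adjoin_le ?_
      rintro _ (rfl | rfl) _ rfl
      exacts [h1.eq, h2.eq]
    exact (Subalgebra.mem_centralizer_iff F |>.mp (this hz) _ rfl).symm
  have hyx : y' * y = (y * y' + y' * y) * 1 + y * y' := by
    rw [mul_one, add_right_comm, CharTwo.add_self_eq_zero, zero_add]
  have step (z : B) (hz : ∀ i, z * v i ∈ N) : ∀ n ∈ N, z * n ∈ N := by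
    intro n hn
    induction hn using Submodule.span_induction with
    | mem x hx => obtain ⟨i, rfl⟩ := hx; exact hz i
    | zero => simp
    | add x x' _ _ hx hx' => rw [mul_add]; exact add_mem hx hx'
    | smul k x _ hx => rw [mul_smul_comm]; exact N.smul_mem k hx
  have haN {n : B} (hn : n ∈ N) : y * (y * n) ∈ N := by
    rw [← mul_assoc, ← pow_two, ← ha]; exact hKN (hF a) hn
  have hbN {n : B} (hn : n ∈ N) : y' * (y' * n) ∈ N := by
    rw [← mul_assoc, ← pow_two, ← hb]; exact hKN (hF b) hn
  have hyN : ∀ n ∈ N, y * n ∈ N := step y fun i => by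
    fin_cases i
    · simpa [v] using hm 1
    · simpa [v] using haN (hm 0)
    · exact hm 3
    · exact haN (hm 2)
  have hyxN : y' * y ∈ N := by
    rw [hyx]; exact add_mem (hKN hs (hm 0)) (hm 3)
  have hyN' : ∀ n ∈ N, y' * n ∈ N := step y' fun i => by
    fin_cases i
    · simpa [v] using hm 2
    · exact hyxN
    · simpa [v] using hbN (hm 0)
    · change y' * (y * y') ∈ N
      have : y' * (y * y') = (y * y' + y' * y) * y' + y * (y' * y') := by
        rw [add_mul, add_right_comm, mul_assoc y y' y', CharTwo.add_self_eq_zero, zero_add,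
          mul_assoc]
      rw [this]
      exact add_mem (hKN hs (hm 2)) (hyN _ (by simpa [v] using hbN (hm 0)))
  have hall (z : B) : ∀ n ∈ N, z * n ∈ N := by
    have hz : z ∈ Algebra.adjoin F {y, y'} := htop ▸ Algebra.mem_top
    induction hz using Algebra.adjoin_induction with
    | mem x hx =>
      rcases hx with rfl | rfl
      exacts [hyN, hyN']
    | algebraMap r => exact fun n hn => hKN (hF r) hn
    | add x x' _ _ hx hx' => intro n hn; rw [add_mul]; exact add_mem (hx n hn) (hx' n hn)
    | mul x x' _ _ hx hx' => intro n hn; rw [mul_assoc]; exact hx _ (hx' n hn)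
  have hspan : ⊤ ≤ N := fun z _ => by simpa [v] using hall z _ (hm 0)
  have hli : LinearIndependent K v := by
    rw [Fintype.linearIndependent_iff]
    intro g hg
    simp only [Fin.sum_univ_four] at hg
    replace hg : (g 0 : B) + g 1 * y + g 2 * y' + g 3 * (y * y') = 0 := by
      simpa [v, Subring.smul_def] using hg
    obtain ⟨h0, h1, h2, h3⟩ := coeffs_eq_zero hne (hK _ _) (hK _ _) (hK _ _) (hK _ _) (hK _ _)
      (hK _ _) (hK _ _) (hK _ _) hg
    intro i
    fin_cases i
    exacts [Subtype.ext h0, Subtype.ext h1, Subtype.ext h2, Subtype.ext h3]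
  exact (Module.finrank_eq_card_basis (Module.Basis.mk hli hspan)).trans (by simp)

set_option synthInstance.maxHeartbeats 1000000 in
/-- If `y` and `y'` are non-commuting square-central elements of a biquaternion division
algebra `A`, then `B = F[y, y']` is a quaternion algebra over its center `K`: `dim_F K ≤ 2`
(`K` is `F·1` or a quadratic extension of `F`) and `B` is a central simple `K`-algebra with
`dim_K B = 4`; in particular there exists `w ∉ F·1`, either Artin–Schreier or square-central,
commuting with both `y` and `y'`. -/
theorem adjoin_squareCentral_isQuaternion (F A : Type*) [Field F] [CharP F 2]
    [DivisionRing A] [Algebra F A]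
    (hcentral : Subalgebra.center F A = ⊥) (hdim : Module.finrank F A = 16)
    (hbiquat : ∃ q : A × A × A × A, IsQuadruple F q)
    (y y' : A) (hy : IsSquareCentral F y) (hy' : IsSquareCentral F y')
    (hne : y * y' ≠ y' * y) :
    Module.finrank F (Subalgebra.center F (Algebra.adjoin F ({y, y'} : Set A))) ≤ 2 ∧
    Algebra.IsCentral (Subring.center (Algebra.adjoin F ({y, y'} : Set A)))
      (Algebra.adjoin F ({y, y'} : Set A)) ∧
    IsSimpleRing (Algebra.adjoin F ({y, y'} : Set A)) ∧
    Module.finrank (Subring.center (Algebra.adjoin F ({y, y'} : Set A)))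
      (Algebra.adjoin F ({y, y'} : Set A)) = 4 ∧
    ∃ w : A, w ∉ Set.range (algebraMap F A) ∧
      (IsArtinSchreier F w ∨ IsSquareCentral F w) ∧
      w * y = y * w ∧ w * y' = y' * w := by
  have hfin : FiniteDimensional F A := Module.finite_of_finrank_pos (by lia)
  have hchar : CharP A 2 := charP_of_injective_algebraMap (algebraMap F A).injective 2
  let B := Algebra.adjoin F ({y, y'} : Set A)
  have hyB : y ∈ B := Algebra.subset_adjoin (by simp)
  have hyB' : y' ∈ B := Algebra.subset_adjoin (by simp)
  have lift {z : A} (hz : z ∈ B) (h : IsSquareCentral F z) :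
      IsSquareCentral F (⟨z, hz⟩ : B) := by
    obtain ⟨r, hr⟩ := h
    exact ⟨r, Subtype.ext hr⟩
  refine ⟨?_, ⟨?_⟩, ?_, ?_, ?_⟩
  · let E : Submodule F A :=
      Submodule.map B.val.toLinearMap (Subalgebra.toSubmodule (Subalgebra.center F B))
    have hE : ∀ e ∈ E, ∀ b ∈ B, Commute e b := by
      rintro _ ⟨e, he, rfl⟩ b hb
      exact congrArg Subtype.val ((Subalgebra.mem_center_iff (R := F)).mp he ⟨b, hb⟩).symm
    have hEB : ∀ e ∈ E, e ∈ B := by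
      rintro _ ⟨e, -, rfl⟩
      exact e.2
    have h := finrank_le_two_of_commute hcentral hdim hne E
      (fun e he => ⟨hE e he y hyB, hE e he y' hyB'⟩) fun e he e' he' => hE e he e' (hEB e' he')
    have hinj : Function.Injective (B.val.toLinearMap : B →ₗ[F] A) := Subtype.val_injective
    rwa [(Submodule.equivMapOfInjective _ hinj _).finrank_eq.symm] at h
  · intro z hz
    rw [Subalgebra.mem_center_iff] at hz
    exact Algebra.mem_bot.mpr ⟨⟨z, Subring.mem_center_iff.mpr hz⟩, rfl⟩
  · let := divisionRingOfFiniteDimensional F B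
    exact (inferInstance : IsSimpleRing B)
  · refine finrank_center_eq_four (F := F) (lift hyB hy) (lift hyB' hy')
      (y := ⟨y, hyB⟩) (y' := ⟨y', hyB'⟩)
      (fun h => hne (congrArg Subtype.val h)) ?_
    have h := Algebra.adjoin_adjoin_coe_preimage (R := F) (s := ({y, y'} : Set A))
    have hset : (Subtype.val ⁻¹' {y, y'} : Set B) = {⟨y, hyB⟩, ⟨y', hyB'⟩} := by
      ext z
      simp [Subtype.ext_iff]
    rw [← hset]
    exact h
  · have key : ∃ w : A, w ∉ Set.range (algebraMap F A) ∧ Commute w y ∧ Commute w y' := by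
      by_contra! hc
      obtain ⟨a, ha⟩ := hy
      obtain ⟨b, hb⟩ := hy'
      have h1 : Commute (y * y' + y' * y) y :=
        commute_mul_add_mul_left (ha ▸ Algebra.commutes a y')
      have h2 : Commute (y * y' + y' * y) y' := by
        rw [add_comm]
        exact commute_mul_add_mul_left (hb ▸ Algebra.commutes b y)
      have hC (c : A) (h : Commute c y) (h' : Commute c y') : c ∈ Set.range (algebraMap F A) := by
        by_contra hn
        exact hc c hn h h'
      obtain ⟨σ, hσ⟩ := hC _ h1 h2
      have hσ0 : σ ≠ 0 := by
        rintro rfl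
        rw [map_zero, ← CharTwo.sub_eq_add] at hσ
        exact hne (sub_eq_zero.mp hσ.symm)
      have := finrank_le_four_of_centralizer ⟨a, ha⟩ ⟨b, hb⟩ hσ0 hσ hC
      lia
    obtain ⟨w, hw, hwy, hwy'⟩ := key
    obtain ⟨p, q, hpq⟩ := exists_sq_eq_of_commute hcentral hdim hne hw hwy hwy'
    obtain ⟨r, hr, hr'⟩ := exists_smul_isArtinSchreier_or_isSquareCentral hw hpq
    exact ⟨r • w, hr, hr', (hwy.smul_left r).eq, (hwy'.smul_left r).eq⟩
end
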